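/- Let 2 < λ ≤ 8 (equivalently λ = 2/α with 1/4 ≤ α < 1) and let u be a solution of the mean field equation Δu = λ(1−e^u) on S². If e^{u(x)} ≤ 12/λ (that is, e^u ≤ 6α) for all x ∈ S², then u is axially symmetric: there exists a unit vector e ∈ ℝ³ such that u(x) = u(x') whenever ⟨x,e⟩ = ⟨x',e⟩. -/

import Mathlib

open Real MeasureTheory

noncomputable section

/-- Euclidean Laplacian on ℝ² via the second iterated derivative. -/
def lap (w : ℝ × ℝ → ℝ) (y : ℝ × ℝ) : ℝ :=
  iteratedFDeriv ℝ 2 w y ![(1, 0), (1, 0)] + iteratedFDeriv ℝ 2 w y ![(0, 1), (0, 1)]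

/-- The unit sphere S² ⊂ ℝ³ (vectors encoded as functions `Fin 3 → ℝ`). -/
def sphere3 : Set (Fin 3 → ℝ) := {x | x 0 ^ 2 + x 1 ^ 2 + x 2 ^ 2 = 1}

/-- Inverse stereographic projection from the north pole. -/
def stereoN (y : ℝ × ℝ) : Fin 3 → ℝ :=
  ![2 * y.1 / (1 + y.1 ^ 2 + y.2 ^ 2), 2 * y.2 / (1 + y.1 ^ 2 + y.2 ^ 2),
    (y.1 ^ 2 + y.2 ^ 2 - 1) / (1 + y.1 ^ 2 + y.2 ^ 2)]

/-- South-pole parametrization of the sphere. -/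
def stereoS (y : ℝ × ℝ) : Fin 3 → ℝ :=
  ![2 * y.1 / (1 + y.1 ^ 2 + y.2 ^ 2), 2 * y.2 / (1 + y.1 ^ 2 + y.2 ^ 2),
    (1 - y.1 ^ 2 - y.2 ^ 2) / (1 + y.1 ^ 2 + y.2 ^ 2)]

/-- `u` is a solution of the mean field equation `Δu = lam (1 - e^u)` on `S²`,
expressed in the two stereographic charts. -/
def IsMFSolution (lam : ℝ) (u : (Fin 3 → ℝ) → ℝ) : Prop :=
  ContinuousOn u sphere3 ∧
  ContDiff ℝ 2 (fun y => u (stereoN y)) ∧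
  ContDiff ℝ 2 (fun y => u (stereoS y)) ∧
  (∀ y : ℝ × ℝ, lap (fun z => u (stereoN z)) y =
    4 * lam * (1 - Real.exp (u (stereoN y))) / (1 + y.1 ^ 2 + y.2 ^ 2) ^ 2) ∧
  (∀ y : ℝ × ℝ, lap (fun z => u (stereoS z)) y =
    4 * lam * (1 - Real.exp (u (stereoS y))) / (1 + y.1 ^ 2 + y.2 ^ 2) ^ 2)

/-- `u` is axially symmetric on `S²`: constant on the level sets of `⟨·, e⟩`
for some unit vector `e`. -/
def AxiallySymmetric (u : (Fin 3 → ℝ) → ℝ) : Prop :=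
  ∃ e : Fin 3 → ℝ, e 0 ^ 2 + e 1 ^ 2 + e 2 ^ 2 = 1 ∧
    ∀ x ∈ sphere3, ∀ x' ∈ sphere3,
      x 0 * e 0 + x 1 * e 1 + x 2 * e 2 = x' 0 * e 0 + x' 1 * e 1 + x' 2 * e 2 →
      u x = u x'

/-- Surface integral over `S²`, written in the north-pole stereographic chart. -/
def sphereIntegral (f : (Fin 3 → ℝ) → ℝ) : ℝ :=
  ∫ y : ℝ × ℝ, f (stereoN y) * (4 / (1 + y.1 ^ 2 + y.2 ^ 2) ^ 2)


abbrev E3 := EuclideanSpace ℝ (Fin 3)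
def S3 : Set E3 := Metric.sphere 0 1
def nrmz (x : E3) : E3 := ‖x‖⁻¹ • x
def shell3 : Set E3 := Metric.closedBall 0 2 \ Metric.ball 0 1
def sig : Measure E3 := Measure.map nrmz (volume.restrict shell3)

lemma mem_S3 {x : E3} : x ∈ S3 ↔ ‖x‖ = 1 := by simp [S3]

lemma measurable_nrmz : Measurable nrmz := by unfold nrmz; fun_prop

lemma measurableSet_shell3 : MeasurableSet shell3 :=
  measurableSet_closedBall.diff measurableSet_ball

lemma isCompact_S3 : IsCompact S3 := isCompact_sphere _ _

lemma shell3_ne {x : E3} (hx : x ∈ shell3) : x ≠ 0 := by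
  rintro rfl; simp [shell3] at hx

lemma nrmz_mem {x : E3} (hx : x ≠ 0) : nrmz x ∈ S3 := by
  rw [mem_S3, nrmz, norm_smul, norm_inv, norm_norm, inv_mul_cancel₀ (norm_ne_zero_iff.mpr hx)]

lemma nrmz_of_mem {x : E3} (hx : x ∈ S3) : nrmz x = x := by
  rw [mem_S3] at hx; simp [nrmz, hx]

instance : IsFiniteMeasure sig := by
  have : IsFiniteMeasure (volume.restrict shell3) := by
    refine ⟨?_⟩
    rw [Measure.restrict_apply_univ]
    exact lt_of_le_of_lt (measure_mono Set.sdiff_subset) (isCompact_closedBall (0:E3) 2).measure_lt_top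
  exact Measure.isFiniteMeasure_map _ _

lemma sig_ae : ∀ᵐ x ∂sig, x ∈ S3 := by
  unfold sig
  refine (ae_map_iff measurable_nrmz.aemeasurable (p := fun x => x ∈ S3) (isCompact_S3.isClosed.measurableSet)).mpr ?_
  filter_upwards [ae_restrict_mem measurableSet_shell3] with x hx
  exact nrmz_mem (shell3_ne hx)

lemma sig_restrict : sig.restrict S3 = sig := Measure.restrict_eq_self_of_ae_mem sig_ae

lemma sig_inv (R : E3 ≃ₗᵢ[ℝ] E3) : MeasurePreserving R sig sig := by
  refine ⟨R.continuous.measurable, ?_⟩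
  have h1 : MeasurePreserving R (volume.restrict shell3) (volume.restrict shell3) := by
    have h := (R.measurePreserving).restrict_preimage measurableSet_shell3
    have h2 : R ⁻¹' shell3 = shell3 := by
      ext x; simp [shell3]
    rwa [h2] at h
  have h3 : R ∘ nrmz = nrmz ∘ R := by
    ext1 x; simp [nrmz]
  rw [sig, Measure.map_map R.continuous.measurable measurable_nrmz, h3,
    ← Measure.map_map measurable_nrmz R.continuous.measurable, h1.map_eq]

lemma integral_comp_R (R : E3 ≃ₗᵢ[ℝ] E3) (f : E3 → ℝ) : ∫ x, f (R x) ∂sig = ∫ x, f x ∂sig :=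
  (sig_inv R).integral_comp R.toHomeomorph.measurableEmbedding f

lemma R_mem (R : E3 ≃ₗᵢ[ℝ] E3) {x : E3} (hx : x ∈ S3) : R x ∈ S3 := by
  rw [mem_S3] at *; simpa using hx

lemma int_cont {F : Type*} [NormedAddCommGroup F] {f : E3 → F} (hf : ContinuousOn f S3) :
    Integrable f sig := by
  have := hf.integrableOn_compact (μ := sig) isCompact_S3
  rwa [IntegrableOn, sig_restrict] at this

lemma int_congr {f g : E3 → ℝ} (h : ∀ x ∈ S3, f x = g x) : ∫ x, f x ∂sig = ∫ x, g x ∂sig :=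
  integral_congr_ae (sig_ae.mono h)

lemma int_mono {f g : E3 → ℝ} (hf : ContinuousOn f S3) (hg : ContinuousOn g S3)
    (h : ∀ x ∈ S3, f x ≤ g x) : ∫ x, f x ∂sig ≤ ∫ x, g x ∂sig :=
  integral_mono_ae (int_cont hf) (int_cont hg) (sig_ae.mono h)

lemma int_nonneg {f : E3 → ℝ} (h : ∀ x ∈ S3, 0 ≤ f x) : 0 ≤ ∫ x, f x ∂sig :=
  integral_nonneg_of_ae (sig_ae.mono h)

lemma int_pos_zero {f : E3 → ℝ} (hf : ContinuousOn f S3) (h0 : ∀ x ∈ S3, 0 ≤ f x)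
    (hI : ∫ x, f x ∂sig ≤ 0) : ∀ x ∈ S3, f x = 0 := by
  have h1 : f =ᵐ[sig] 0 := by
    rw [← integral_eq_zero_iff_of_nonneg_ae (sig_ae.mono h0) (int_cont hf)]
    exact le_antisymm hI (int_nonneg h0)
  have h2 : ∀ᵐ x ∂(volume.restrict shell3), f (nrmz x) = 0 :=
    (ae_of_ae_map measurable_nrmz.aemeasurable h1)
  intro x hx
  by_contra hne
  -- open set
  let U : Set E3 := {y | 1 < ‖y‖ ∧ ‖y‖ < 2}
  have hU : IsOpen U := (isOpen_lt continuous_const continuous_norm).inter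
    (isOpen_lt continuous_norm continuous_const)
  have hUs : U ⊆ shell3 := by
    intro y hy; simp only [shell3, Set.mem_sdiff, Metric.mem_closedBall, Metric.mem_ball, dist_zero_right]
    exact ⟨hy.2.le, not_lt.mpr hy.1.le⟩
  have hc : ContinuousOn (fun y => f (nrmz y)) U := by
    refine hf.comp ?_ (fun y hy => nrmz_mem (shell3_ne (hUs hy)))
    unfold nrmz
    refine ContinuousOn.smul (ContinuousOn.inv₀ continuous_norm.continuousOn ?_) continuousOn_id
    intro y hy; exact norm_ne_zero_iff.mpr (shell3_ne (hUs hy))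
  have hV : IsOpen (U ∩ (fun y => f (nrmz y)) ⁻¹' {0}ᶜ) := hc.isOpen_inter_preimage hU isOpen_compl_singleton
  have hxn : ‖x‖ = 1 := mem_S3.mp hx
  have hne' : (U ∩ (fun y => f (nrmz y)) ⁻¹' {0}ᶜ).Nonempty := by
    refine ⟨(3/2:ℝ) • x, ⟨?_, ?_⟩, ?_⟩
    · simp only [norm_smul, hxn]; norm_num
    · simp only [norm_smul, hxn]; norm_num
    · have : nrmz ((3/2:ℝ) • x) = x := by
        simp only [nrmz, norm_smul, hxn, smul_smul]; norm_num
      simpa [this] using hne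
  have hpos := hV.measure_pos volume hne'
  have h3 : volume (U ∩ (fun y => f (nrmz y)) ⁻¹' {0}ᶜ) = 0 := by
    rw [ae_restrict_iff' measurableSet_shell3] at h2
    refine measure_mono_null ?_ h2
    intro y hy
    simp only [Set.mem_compl_iff, Set.mem_ofPred_eq]
    exact fun h => hy.2 (h (hUs hy.1))
  exact absurd h3 hpos.ne'

/-- C¹ near the sphere, with gradient `g`. -/
structure C1 (G : E3 → ℝ) (g : E3 → E3) : Prop where
  cont : ContinuousOn g S3
  der : ∀ x ∈ S3, HasFDerivAt G (innerSL ℝ (g x)) x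

lemma C1.contG {G : E3 → ℝ} {g} (h : C1 G g) : ContinuousOn G S3 :=
  fun x hx => (h.der x hx).continuousAt.continuousWithinAt

/-- generator of the rotation -/
def Jm (p q x : E3) : E3 := inner ℝ p x • q - inner ℝ q x • p

def rotL (p q : E3) (θ : ℝ) : E3 →ₗ[ℝ] E3 where
  toFun x := x + ((cos θ - 1) * inner ℝ p x - sin θ * inner ℝ q x) • p
    + (sin θ * inner ℝ p x + (cos θ - 1) * inner ℝ q x) • q
  map_add' x y := by simp only [inner_add_right]; module
  map_smul' c x := by simp only [inner_smul_right, RingHom.id_apply]; module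

structure ON2 (p q : E3) : Prop where
  p1 : inner ℝ p p = (1:ℝ)
  q1 : inner ℝ q q = (1:ℝ)
  pq : inner ℝ p q = (0:ℝ)

lemma ON2.qp {p q : E3} (h : ON2 p q) : inner ℝ q p = (0:ℝ) := by rw [real_inner_comm]; exact h.pq

lemma rotL_norm {p q : E3} (h : ON2 p q) (θ : ℝ) (x : E3) : ‖rotL p q θ x‖ = ‖x‖ := by
  have : inner ℝ (rotL p q θ x) (rotL p q θ x) = inner ℝ x x := by
    simp only [rotL, LinearMap.coe_mk, AddHom.coe_mk, inner_add_left, inner_add_right,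
      inner_smul_left, inner_smul_right, h.p1, h.q1, h.pq, h.qp, conj_trivial]
    rw [real_inner_comm p x, real_inner_comm q x]
    have := sin_sq_add_cos_sq θ
    generalize inner ℝ p x = a
    generalize inner ℝ q x = b
    linear_combination (a^2+b^2) * this
  rw [real_inner_self_eq_norm_sq, real_inner_self_eq_norm_sq] at this
  exact (sq_eq_sq₀ (norm_nonneg _) (norm_nonneg _)).mp this

def rot {p q : E3} (h : ON2 p q) (θ : ℝ) : E3 ≃ₗᵢ[ℝ] E3 :=
  LinearIsometry.toLinearIsometryEquiv ⟨rotL p q θ, rotL_norm h θ⟩ rfl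

lemma rot_apply {p q : E3} (h : ON2 p q) (θ : ℝ) (x : E3) : rot h θ x =
   x + ((cos θ - 1) * inner ℝ p x - sin θ * inner ℝ q x) • p
    + (sin θ * inner ℝ p x + (cos θ - 1) * inner ℝ q x) • q := rfl

lemma rot_zero {p q : E3} (h : ON2 p q) (x : E3) : rot h 0 x = x := by
  simp [rot_apply]

lemma rot_deriv {p q : E3} (h : ON2 p q) (θ : ℝ) (x : E3) :
    HasDerivAt (fun θ => rot h θ x) (Jm p q (rot h θ x)) θ := by
  simp only [rot_apply]
  have e : Jm p q (x + ((cos θ - 1) * inner ℝ p x - sin θ * inner ℝ q x) • p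
    + (sin θ * inner ℝ p x + (cos θ - 1) * inner ℝ q x) • q) =
      0 + ((-sin θ) * inner ℝ p x - cos θ * inner ℝ q x) • p
      + (cos θ * inner ℝ p x + (-sin θ) * inner ℝ q x) • q := by
    simp only [Jm, inner_add_right, inner_smul_right, h.p1, h.q1, h.pq, h.qp]
    module
  rw [e]
  refine ((hasDerivAt_const θ x).add (HasDerivAt.smul_const ?_ p)).add (HasDerivAt.smul_const ?_ q)
  · exact (((hasDerivAt_cos θ).sub_const 1).mul_const _).sub ((hasDerivAt_sin θ).mul_const _)
  · exact ((hasDerivAt_sin θ).mul_const _).add (((hasDerivAt_cos θ).sub_const 1).mul_const _)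

lemma continuous_Jm (p q : E3) : Continuous (Jm p q) := by unfold Jm; fun_prop

lemma exists_bound {F : Type*} [NormedAddCommGroup F] {f : E3 → F} (hf : ContinuousOn f S3) : ∃ C, 0 ≤ C ∧ ∀ x ∈ S3, ‖f x‖ ≤ C := by
  obtain ⟨C, hC⟩ := isCompact_S3.exists_bound_of_continuousOn hf
  exact ⟨max C 0, le_max_right _ _, fun x hx => (hC x hx).trans (le_max_left _ _)⟩

lemma flow_deriv {p q : E3} (h : ON2 p q) {H : E3 → ℝ} {g : E3 → E3} (hH : C1 H g)
    {K : E3 → ℝ} (hK : ContinuousOn K S3) :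
    HasDerivAt (fun θ => ∫ x, H (rot h θ x) * K x ∂sig)
      (∫ x, inner ℝ (g x) (Jm p q x) * K x ∂sig) 0 := by
  have hgc : ContinuousOn (fun x => inner ℝ (g x) (Jm p q x)) S3 :=
    hH.cont.inner (continuous_Jm p q).continuousOn
  obtain ⟨C, hC0, hC⟩ := exists_bound hgc
  obtain ⟨C', hC'0, hC'⟩ := exists_bound hK
  have hmap : ∀ θ, Set.MapsTo (rot h θ) S3 S3 := fun θ x hx => R_mem _ hx
  have hcomp : ∀ θ, ContinuousOn (fun x => H (rot h θ x) * K x) S3 := fun θ =>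
    (hH.contG.comp (rot h θ).continuous.continuousOn (hmap θ)).mul hK
  have := hasDerivAt_integral_of_dominated_loc_of_deriv_le (μ := sig) (𝕜 := ℝ)
    (F := fun θ x => H (rot h θ x) * K x)
    (F' := fun θ x => inner ℝ (g (rot h θ x)) (Jm p q (rot h θ x)) * K x) (x₀ := 0)
    (s := Set.univ) (bound := fun _ => C * C') (Filter.univ_mem)
    (Filter.Eventually.of_forall fun θ => (int_cont (hcomp θ)).aestronglyMeasurable)
    (int_cont (hcomp 0))
    (int_cont ((hgc.comp (rot h 0).continuous.continuousOn (hmap 0)).mul hK)).aestronglyMeasurable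
    (sig_ae.mono fun x hx θ _ => by
      rw [norm_mul]
      exact mul_le_mul (hC _ (hmap θ hx)) (hC' x hx) (norm_nonneg _) hC0)
    (integrable_const _)
    (sig_ae.mono fun x hx θ _ => by
      have h1 := (hH.der _ (hmap θ hx)).comp_hasDerivAt θ (rot_deriv h θ x)
      simpa using h1.mul_const (K x))
  simpa [rot_zero] using this.2

lemma ibp {p q : E3} (h : ON2 p q) {H : E3 → ℝ} {g : E3 → E3} (hH : C1 H g) :
    ∫ x, inner ℝ (g x) (Jm p q x) ∂sig = 0 := by
  have h1 := flow_deriv h hH (K := fun _ => 1) continuousOn_const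
  simp only [mul_one] at h1
  simp only [integral_comp_R] at h1
  exact h1.unique (hasDerivAt_const _ _)


def Gm (x a b : E3) : ℝ := inner ℝ a b - inner ℝ x a * inner ℝ x b

def ee (k : Fin 3) : E3 := EuclideanSpace.single k 1

lemma ON2_ee {i j : Fin 3} (h : i ≠ j) : ON2 (ee i) (ee j) := by
  constructor <;> simp [ee, EuclideanSpace.inner_single_left, h]

lemma inner_ee (k : Fin 3) (x : E3) : inner ℝ (ee k) x = x k := by
  simp [ee, EuclideanSpace.inner_single_left]

lemma inner_ee' (k : Fin 3) (x : E3) : inner ℝ x (ee k) = x k := by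
  rw [real_inner_comm, inner_ee]

lemma inner3 (x y : E3) : inner ℝ x y = x 0 * y 0 + x 1 * y 1 + x 2 * y 2 := by
  simp [PiLp.inner_apply, Fin.sum_univ_three]; ring

lemma S3_sq {x : E3} (hx : x ∈ S3) : x 0 ^ 2 + x 1 ^ 2 + x 2 ^ 2 = 1 := by
  rw [mem_S3] at hx
  have := real_inner_self_eq_norm_sq x
  rw [hx, inner3] at this; linarith

lemma S3_inner {x : E3} (hx : x ∈ S3) : inner ℝ x x = (1:ℝ) := by
  rw [mem_S3] at hx
  rw [real_inner_self_eq_norm_sq x, hx]; norm_num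

lemma decomp3 (x : E3) : x = x 0 • ee 0 + x 1 • ee 1 + x 2 • ee 2 := by
  ext i; fin_cases i <;> simp [ee]

namespace C1

lemma congr' {G : E3 → ℝ} {g g' : E3 → E3} (h : C1 G g) (e : ∀ x ∈ S3, g x = g' x) : C1 G g' :=
  ⟨h.cont.congr fun x hx => (e x hx).symm, fun x hx => e x hx ▸ h.der x hx⟩

lemma const (c : ℝ) : C1 (fun _ => c) (fun _ => 0) :=
  ⟨continuousOn_const, fun x _ => by simpa using hasFDerivAt_const c x⟩

lemma add {G K : E3 → ℝ} {g k : E3 → E3} (h : C1 G g) (h' : C1 K k) :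
    C1 (fun x => G x + K x) (fun x => g x + k x) :=
  ⟨h.cont.add h'.cont, fun x hx => by simpa [map_add] using (h.der x hx).fun_add (h'.der x hx)⟩

lemma sub {G K : E3 → ℝ} {g k : E3 → E3} (h : C1 G g) (h' : C1 K k) :
    C1 (fun x => G x - K x) (fun x => g x - k x) :=
  ⟨h.cont.sub h'.cont, fun x hx => by simpa [map_sub] using (h.der x hx).fun_sub (h'.der x hx)⟩

lemma smul {G : E3 → ℝ} {g : E3 → E3} (c : ℝ) (h : C1 G g) :
    C1 (fun x => c * G x) (fun x => c • g x) :=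
  ⟨h.cont.const_smul c, fun x hx => by simpa [map_smul] using (h.der x hx).const_mul c⟩

lemma mul {G K : E3 → ℝ} {g k : E3 → E3} (h : C1 G g) (h' : C1 K k) :
    C1 (fun x => G x * K x) (fun x => G x • k x + K x • g x) :=
  ⟨(h.contG.smul h'.cont).add (h'.contG.smul h.cont),
    fun x hx => by simpa [map_add, map_smul] using (h.der x hx).fun_mul (h'.der x hx)⟩

lemma compR {G : E3 → ℝ} {g : E3 → E3} (h : C1 G g) (R : E3 ≃ₗᵢ[ℝ] E3) :
    C1 (fun x => G (R x)) (fun x => R.symm (g (R x))) := by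
  refine ⟨R.symm.continuous.comp_continuousOn
    (h.cont.comp R.continuous.continuousOn fun x hx => R_mem R hx), fun x hx => ?_⟩
  have h1 := (h.der _ (R_mem R hx)).comp x (R.toContinuousLinearEquiv.hasFDerivAt (x := x))
  refine h1.congr_fderiv ?_
  ext v
  simp only [ContinuousLinearMap.comp_apply, innerSL_apply_apply]
  have := R.inner_map_map (R.symm (g (R x))) v
  simp only [LinearIsometryEquiv.apply_symm_apply] at this
  exact this

lemma lin (a : E3) : C1 (fun x => inner ℝ a x) (fun _ => a) :=
  ⟨continuousOn_const, fun x _ => (innerSL ℝ a).hasFDerivAt⟩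

lemma comp {G : E3 → ℝ} {g : E3 → E3} (h : C1 G g) {k k' : ℝ → ℝ}
    (hk : ∀ x ∈ S3, HasDerivAt k (k' (G x)) (G x)) (hk' : ContinuousOn (fun x => k' (G x)) S3) :
    C1 (fun x => k (G x)) (fun x => k' (G x) • g x) := by
  refine ⟨hk'.smul h.cont, fun x hx => ?_⟩
  have := (hk x hx).comp_hasFDerivAt x (h.der x hx)
  simp only [map_smul]
  exact this

lemma exp {G : E3 → ℝ} {g : E3 → E3} (h : C1 G g) :
    C1 (fun x => Real.exp (G x)) (fun x => Real.exp (G x) • g x) :=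
  h.comp (fun x _ => Real.hasDerivAt_exp _) (Real.continuous_exp.comp_continuousOn h.contG)

end C1

lemma cont_Gm {a b : E3 → E3} (ha : ContinuousOn a S3) (hb : ContinuousOn b S3) :
    ContinuousOn (fun x => Gm x (a x) (b x)) S3 :=
  (ha.inner hb).sub ((continuousOn_id.inner ha).mul (continuousOn_id.inner hb))

lemma Gm_R (R : E3 ≃ₗᵢ[ℝ] E3) (x a b : E3) : Gm x (R.symm a) b = Gm (R x) a (R b) := by
  unfold Gm
  have h1 := R.inner_map_map (R.symm a) b
  have h2 := R.inner_map_map x (R.symm a)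
  have h3 := R.inner_map_map x b
  simp only [LinearIsometryEquiv.apply_symm_apply] at h1 h2
  rw [h1, h2, h3]

lemma Gm_self_nonneg {x : E3} (hx : x ∈ S3) (a : E3) : 0 ≤ Gm x a a := by
  unfold Gm
  have := S3_sq hx
  rw [inner3, inner3]
  nlinarith [sq_nonneg (x 0 * a 1 - x 1 * a 0), sq_nonneg (x 1 * a 2 - x 2 * a 1), sq_nonneg (x 2 * a 0 - x 0 * a 2)]

lemma Gm_comm (x a b : E3) : Gm x a b = Gm x b a := by
  unfold Gm; rw [real_inner_comm]; ring

structure C2 (G : E3 → ℝ) (g : E3 → E3) (H : E3 → E3 →L[ℝ] E3) : Prop where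
  c1 : C1 G g
  der : ∀ x ∈ S3, HasFDerivAt g (H x) x
  cont : ContinuousOn H S3

def SL (x g : E3) (H : E3 →L[ℝ] E3) : ℝ :=
  H (ee 0) 0 + H (ee 1) 1 + H (ee 2) 2 - inner ℝ (H x) x - 2 * inner ℝ g x

lemma Jm_ee (i j : Fin 3) (x : E3) : Jm (ee i) (ee j) x = x i • ee j - x j • ee i := by
  simp [Jm, inner_ee]

def JmL (p q : E3) : E3 →L[ℝ] E3 := (innerSL ℝ p).smulRight q - (innerSL ℝ q).smulRight p

lemma JmL_apply (p q x : E3) : JmL p q x = Jm p q x := by simp [JmL, Jm]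

lemma Jm_skew (p q x y : E3) : inner ℝ x (Jm p q y) = - inner ℝ (Jm p q x) y := by
  simp only [Jm, inner_sub_right, inner_sub_left, inner_smul_left, inner_smul_right, conj_trivial]
  rw [real_inner_comm x q, real_inner_comm x p]
  ring

lemma C2.X {G : E3 → ℝ} {g : E3 → E3} {H : E3 → E3 →L[ℝ] E3} (h : C2 G g H) (p q : E3) :
    C1 (fun x => inner ℝ (g x) (Jm p q x))
      (fun x => (H x).adjoint (Jm p q x) - Jm p q (g x)) := by
  refine ⟨?_, fun x hx => ?_⟩
  · refine ContinuousOn.sub (ContinuousOn.clm_apply ?_ (continuous_Jm p q).continuousOn) ?_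
    · exact (ContinuousLinearMap.adjoint (𝕜 := ℝ) (E := E3) (F := E3)).continuous.comp_continuousOn h.cont
    · exact (continuous_Jm p q).comp_continuousOn h.c1.cont
  · have h1 : HasFDerivAt (fun x => Jm p q x) (JmL p q) x := by
      have e : (fun x => Jm p q x) = JmL p q := funext fun x => (JmL_apply p q x).symm
      rw [e]
      exact (JmL p q).hasFDerivAt (x := x)
    refine ((h.der x hx).inner ℝ h1).congr_fderiv ?_
    ext v
    simp only [ContinuousLinearMap.comp_apply, innerSL_apply_apply, fderivInnerCLM_apply, inner_sub_left,
      ContinuousLinearMap.prod_apply, ContinuousLinearMap.adjoint_inner_left, JmL_apply]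
    rw [Jm_skew p q (g x) v, real_inner_comm (Jm p q x)]
    ring

lemma C2.ibp {G : E3 → ℝ} {g : E3 → E3} {H : E3 → E3 →L[ℝ] E3} (h : C2 G g H)
    {χ : E3 → ℝ} {c : E3 → E3} (hχ : C1 χ c) {p q : E3} (hpq : ON2 p q) :
    ∫ x, ((inner ℝ (H x (Jm p q x)) (Jm p q x) + inner ℝ (g x) (Jm p q (Jm p q x))) * χ x
      + inner ℝ (g x) (Jm p q x) * inner ℝ (c x) (Jm p q x)) ∂sig = 0 := by
  rw [← _root_.ibp hpq ((h.X p q).mul hχ)]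
  refine int_congr fun x hx => ?_
  simp only [inner_add_left, inner_smul_left, inner_sub_left, ContinuousLinearMap.adjoint_inner_left, conj_trivial]
  rw [Jm_skew p q (g x) (Jm p q x), real_inner_comm (Jm p q x) (H x _)]
  ring

lemma C2.contSL {G : E3 → ℝ} {g : E3 → E3} {H : E3 → E3 →L[ℝ] E3} (h : C2 G g H) :
    ContinuousOn (fun x => SL x (g x) (H x)) S3 := by
  have hk : ∀ k : Fin 3, ContinuousOn (fun x => H x (ee k) k) S3 := fun k => by
    have : ContinuousOn (fun x => H x (ee k)) S3 := h.cont.clm_apply continuousOn_const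
    exact (continuous_apply k).comp_continuousOn ((PiLp.continuous_ofLp 2 _).comp_continuousOn this)
  unfold SL
  exact ((((hk 0).add (hk 1)).add (hk 2)).sub ((h.cont.clm_apply continuousOn_id).inner continuousOn_id)).sub
    (continuousOn_const.mul (h.c1.cont.inner continuousOn_id))

lemma green {G : E3 → ℝ} {g : E3 → E3} {H : E3 → E3 →L[ℝ] E3} (h : C2 G g H)
    {χ : E3 → ℝ} {c : E3 → E3} (hχ : C1 χ c) :
    ∫ x, Gm x (g x) (c x) ∂sig = - ∫ x, SL x (g x) (H x) * χ x ∂sig := by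
  have h01 := h.ibp hχ (ON2_ee (i := 0) (j := 1) (by decide))
  have h12 := h.ibp hχ (ON2_ee (i := 1) (j := 2) (by decide))
  have h20 := h.ibp hχ (ON2_ee (i := 2) (j := 0) (by decide))
  have hIntg : ∀ p q : E3, Integrable (fun x => ((inner ℝ (H x (Jm p q x)) (Jm p q x) + inner ℝ (g x) (Jm p q (Jm p q x))) * χ x
      + inner ℝ (g x) (Jm p q x) * inner ℝ (c x) (Jm p q x))) sig := by
    intro p q
    have hj := (continuous_Jm p q).continuousOn (s := S3)
    have hjj := ((continuous_Jm p q).comp (continuous_Jm p q)).continuousOn (s := S3)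
    exact int_cont (((((h.cont.clm_apply hj).inner hj).add (h.c1.cont.inner hjj)).mul hχ.contG).add
      ((h.c1.cont.inner hj).mul (hχ.cont.inner hj)))
  have hsum : ∫ x, (Gm x (g x) (c x) + SL x (g x) (H x) * χ x) ∂sig = 0 := by
    have hA := integral_add (hIntg (ee 0) (ee 1)) (hIntg (ee 1) (ee 2))
    have hB := integral_add ((hIntg (ee 0) (ee 1)).add (hIntg (ee 1) (ee 2))) (hIntg (ee 2) (ee 0))
    simp only [Pi.add_apply] at hB
    rw [hA, h01, h12, h20, add_zero, add_zero] at hB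
    rw [← hB]
    refine int_congr fun x hx => ?_
    have hs := S3_sq hx
    have hHx : H x x = x 0 • H x (ee 0) + x 1 • H x (ee 1) + x 2 • H x (ee 2) := by
      have hL : ∀ L : E3 →L[ℝ] E3, L x = x 0 • L (ee 0) + x 1 • L (ee 1) + x 2 • L (ee 2) := fun L => by
        conv_lhs => rw [decomp3 x]
        simp only [map_add, map_smul]
      exact hL _
    simp only [Gm, SL, hHx, Jm_ee, map_sub, map_smul, inner3]
    simp only [ee, PiLp.sub_apply, PiLp.smul_apply, PiLp.add_apply, EuclideanSpace.single_apply, smul_eq_mul]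
    simp
    generalize H x (EuclideanSpace.single 0 1) = A0
    generalize H x (EuclideanSpace.single 1 1) = A1
    generalize H x (EuclideanSpace.single 2 1) = A2
    have h0 : x 2 ^ 2 = 1 - x 0 ^2 - x 1 ^2 := by linarith
    linear_combination (-(g x 0 * c x 0 + g x 1 * c x 1 + g x 2 * c x 2) - (A0 0 + A1 1 + A2 2) * χ x) * hs
  have hG := int_cont (cont_Gm h.c1.cont hχ.cont)
  have hS : Integrable (fun x => SL x (g x) (H x) * χ x) sig := int_cont (h.contSL.mul hχ.contG)
  rw [integral_add hG hS] at hsum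
  linarith

lemma zonal_C2 (a : E3) {k k' k'' : ℝ → ℝ} (h1 : ∀ x ∈ S3, HasDerivAt k (k' (inner ℝ a x)) (inner ℝ a x))
    (h2 : ∀ x ∈ S3, HasDerivAt k' (k'' (inner ℝ a x)) (inner ℝ a x))
    (h3 : ContinuousOn (fun x : E3 => k'' (inner ℝ a x)) S3) :
    C2 (fun x => k (inner ℝ a x)) (fun x => k' (inner ℝ a x) • a)
      (fun x => (k'' (inner ℝ a x) • innerSL ℝ a).smulRight a) := by
  have hl := C1.lin a
  have hk' : ContinuousOn (fun x : E3 => k' (inner ℝ a x)) S3 := fun x hx =>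
    ((h2 x hx).continuousAt.comp (f := fun x : E3 => inner ℝ a x) (by fun_prop)).continuousWithinAt
  refine ⟨hl.comp h1 hk', fun x hx => ?_, ?_⟩
  · have := (h2 x hx).comp_hasFDerivAt x (hl.der x hx)
    exact this.smul_const a
  · have : ContinuousOn (fun x => k'' (inner ℝ a x) • (innerSL ℝ a).smulRight a) S3 :=
      h3.smul continuousOn_const
    refine this.congr fun x _ => ?_
    ext v i
    simp [mul_assoc]

lemma green_zonal (a : E3) {k k' k'' : ℝ → ℝ} (h1 : ∀ x ∈ S3, HasDerivAt k (k' (inner ℝ a x)) (inner ℝ a x))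
    (h2 : ∀ x ∈ S3, HasDerivAt k' (k'' (inner ℝ a x)) (inner ℝ a x))
    (h3 : ContinuousOn (fun x : E3 => k'' (inner ℝ a x)) S3)
    {χ : E3 → ℝ} {c : E3 → E3} (hχ : C1 χ c) :
    ∫ x, Gm x (k' (inner ℝ a x) • a) (c x) ∂sig =
      - ∫ x, (k'' (inner ℝ a x) * (inner ℝ a a - (inner ℝ a x) ^ 2) - 2 * inner ℝ a x * k' (inner ℝ a x)) * χ x ∂sig := by
  rw [green (zonal_C2 a h1 h2 h3) hχ]
  congr 1
  refine int_congr fun x _ => ?_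
  congr 1
  simp only [SL, ContinuousLinearMap.smulRight_apply, ContinuousLinearMap.smul_apply, innerSL_apply_apply,
    inner_smul_left, PiLp.smul_apply, smul_eq_mul, inner_ee', conj_trivial]
  rw [inner3 a a]; ring


/-! ### Dirichlet form -/

def IP (f h : E3 → ℝ) : ℝ := ∫ x, f x * h x ∂sig
def Dir (f h : E3 → ℝ) : ℝ := ∫ x, Gm x (gradient f x) (gradient h x) ∂sig
def CC (f : E3 → ℝ) : Prop := C1 f (gradient f)

lemma C1.grad {f : E3 → ℝ} {a : E3 → E3} (h : C1 f a) {x : E3} (hx : x ∈ S3) : gradient f x = a x := by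
  apply HasGradientAt.gradient
  rw [hasGradientAt_iff_hasFDerivAt]
  exact h.der x hx

lemma C1.CC {f : E3 → ℝ} {a : E3 → E3} (h : C1 f a) : CC f :=
  C1.congr' h fun _ hx => (h.grad hx).symm

lemma C1.Dir {f k : E3 → ℝ} {a b : E3 → E3} (h : C1 f a) (h' : C1 k b) :
    Dir f k = ∫ x, Gm x (a x) (b x) ∂sig :=
  int_congr fun x hx => by rw [h.grad hx, h'.grad hx]

lemma IP_comm (f h : E3 → ℝ) : IP f h = IP h f := by unfold IP; simp only [mul_comm]
lemma Dir_comm (f h : E3 → ℝ) : Dir f h = Dir h f := by unfold Dir; simp only [Gm_comm]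

lemma int_mul {f g : E3 → ℝ} (hf : ContinuousOn f S3) (hg : ContinuousOn g S3) :
    Integrable (fun x => f x * g x) sig := int_cont (hf.mul hg)

lemma IP_add {f g h : E3 → ℝ} (hf : ContinuousOn f S3) (hg : ContinuousOn g S3) (hh : ContinuousOn h S3) :
    IP (fun x => f x + g x) h = IP f h + IP g h := by
  unfold IP
  rw [← integral_add (int_mul hf hh) (int_mul hg hh)]
  simp only [add_mul]

lemma IP_sub {f g h : E3 → ℝ} (hf : ContinuousOn f S3) (hg : ContinuousOn g S3) (hh : ContinuousOn h S3) :
    IP (fun x => f x - g x) h = IP f h - IP g h := by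
  unfold IP
  rw [← integral_sub (int_mul hf hh) (int_mul hg hh)]
  simp only [sub_mul]

lemma IP_smul (c : ℝ) (f h : E3 → ℝ) : IP (fun x => c * f x) h = c * IP f h := by
  unfold IP
  rw [← integral_const_mul]
  simp only [mul_assoc]

lemma IP_add_r {f g h : E3 → ℝ} (hf : ContinuousOn f S3) (hg : ContinuousOn g S3) (hh : ContinuousOn h S3) :
    IP h (fun x => f x + g x) = IP h f + IP h g := by
  rw [IP_comm, IP_add hf hg hh, IP_comm, IP_comm g]

lemma IP_sub_r {f g h : E3 → ℝ} (hf : ContinuousOn f S3) (hg : ContinuousOn g S3) (hh : ContinuousOn h S3) :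
    IP h (fun x => f x - g x) = IP h f - IP h g := by
  rw [IP_comm, IP_sub hf hg hh, IP_comm, IP_comm g]

lemma IP_smul_r (c : ℝ) (f h : E3 → ℝ) : IP h (fun x => c * f x) = c * IP h f := by
  rw [IP_comm, IP_smul, IP_comm]

lemma IP_self_nonneg (f : E3 → ℝ) : 0 ≤ IP f f := int_nonneg fun _ _ => mul_self_nonneg _

lemma IP_congr {f g h k : E3 → ℝ} (e : ∀ x ∈ S3, f x = g x) (e' : ∀ x ∈ S3, h x = k x) :
    IP f h = IP g k := int_congr fun x hx => by rw [e x hx, e' x hx]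

lemma CC.add {f g : E3 → ℝ} (hf : CC f) (hg : CC g) : CC (fun x => f x + g x) := (C1.add hf hg).CC
lemma CC.sub {f g : E3 → ℝ} (hf : CC f) (hg : CC g) : CC (fun x => f x - g x) := (C1.sub hf hg).CC
lemma CC.smul {f : E3 → ℝ} (c : ℝ) (hf : CC f) : CC (fun x => c * f x) := (C1.smul c hf).CC
lemma CC.mul {f g : E3 → ℝ} (hf : CC f) (hg : CC g) : CC (fun x => f x * g x) := (C1.mul hf hg).CC
lemma CC.contG {f : E3 → ℝ} (hf : CC f) : ContinuousOn f S3 := C1.contG hf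

lemma Dir_add {f g h : E3 → ℝ} (hf : CC f) (hg : CC g) (hh : CC h) :
    Dir (fun x => f x + g x) h = Dir f h + Dir g h := by
  rw [(C1.add hf hg).Dir hh]
  unfold Dir
  rw [← integral_add (int_cont (cont_Gm hf.cont hh.cont)) (int_cont (cont_Gm hg.cont hh.cont))]
  congr 1; ext x; simp only [Gm, inner_add_left, inner_add_right]; ring

lemma Dir_sub {f g h : E3 → ℝ} (hf : CC f) (hg : CC g) (hh : CC h) :
    Dir (fun x => f x - g x) h = Dir f h - Dir g h := by
  rw [(C1.sub hf hg).Dir hh]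
  unfold Dir
  rw [← integral_sub (int_cont (cont_Gm hf.cont hh.cont)) (int_cont (cont_Gm hg.cont hh.cont))]
  congr 1; ext x; simp only [Gm, inner_sub_left, inner_sub_right]; ring

lemma Dir_smul {f h : E3 → ℝ} (c : ℝ) (hf : CC f) (hh : CC h) :
    Dir (fun x => c * f x) h = c * Dir f h := by
  rw [(C1.smul c hf).Dir hh]
  unfold Dir
  rw [← integral_const_mul]
  congr 1; ext x; simp only [Gm, inner_smul_left, inner_smul_right, conj_trivial]; ring

lemma Dir_add_r {f g h : E3 → ℝ} (hf : CC f) (hg : CC g) (hh : CC h) :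
    Dir h (fun x => f x + g x) = Dir h f + Dir h g := by
  rw [Dir_comm, Dir_add hf hg hh, Dir_comm, Dir_comm g]

lemma Dir_sub_r {f g h : E3 → ℝ} (hf : CC f) (hg : CC g) (hh : CC h) :
    Dir h (fun x => f x - g x) = Dir h f - Dir h g := by
  rw [Dir_comm, Dir_sub hf hg hh, Dir_comm, Dir_comm g]

lemma Dir_smul_r {f h : E3 → ℝ} (c : ℝ) (hf : CC f) (hh : CC h) :
    Dir h (fun x => c * f x) = c * Dir h f := by
  rw [Dir_comm, Dir_smul c hf hh, Dir_comm]

lemma Dir_self_nonneg (f : E3 → ℝ) : 0 ≤ Dir f f := int_nonneg fun _ hx => Gm_self_nonneg hx _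

/-! ### polynomial spaces -/

def PP (N : ℕ) : Submodule ℝ (E3 → ℝ) :=
  Submodule.span ℝ {f | ∃ (a : E3) (k : ℕ), k ≤ N ∧ f = fun x => (inner ℝ a x : ℝ) ^ k}

lemma PP_mono {N M : ℕ} (h : N ≤ M) : PP N ≤ PP M :=
  Submodule.span_mono fun _ ⟨a, k, hk, e⟩ => ⟨a, k, hk.trans h, e⟩

lemma ppow_mem (a : E3) {k N : ℕ} (h : k ≤ N) : (fun x => (inner ℝ a x : ℝ) ^ k) ∈ PP N :=
  Submodule.subset_span ⟨a, k, h, rfl⟩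

lemma CC_pow (a : E3) (k : ℕ) : CC (fun x => (inner ℝ a x : ℝ) ^ k) :=
  ((C1.lin a).comp (k := fun t => t ^ k) (k' := fun t => k * t ^ (k-1))
    (fun x _ => hasDerivAt_pow k _) (by fun_prop)).CC

lemma PP_CC {N : ℕ} {p : E3 → ℝ} (hp : p ∈ PP N) : CC p := by
  induction hp using Submodule.span_induction with
  | mem f hf => obtain ⟨a, k, -, rfl⟩ := hf; exact CC_pow a k
  | zero => exact (C1.const 0).CC
  | add f g _ _ hf hg => exact hf.add hg
  | smul c f _ hf => exact hf.smul c

lemma Dir_pow (a : E3) (k : ℕ) {χ : E3 → ℝ} (hχ : CC χ) :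
    Dir (fun x => (inner ℝ a x : ℝ) ^ k) χ =
      k * (k + 1) * IP (fun x => (inner ℝ a x : ℝ) ^ k) χ
      - k * (k - 1) * inner ℝ a a * IP (fun x => (inner ℝ a x : ℝ) ^ (k - 2)) χ := by
  have h1 : ∀ x ∈ S3, HasDerivAt (fun t : ℝ => t ^ k) ((fun t : ℝ => k * t ^ (k-1)) (inner ℝ a x)) (inner ℝ a x) :=
    fun x _ => hasDerivAt_pow k _
  have h2 : ∀ x ∈ S3, HasDerivAt (fun t : ℝ => k * t ^ (k-1))
      ((fun t : ℝ => (k:ℝ) * (((k-1 : ℕ) : ℝ) * t ^ (k-1-1))) (inner ℝ a x)) (inner ℝ a x) :=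
    fun x _ => (hasDerivAt_pow (k-1) _).const_mul _
  have hd := ((C1.lin a).comp (k := fun t : ℝ => t ^ k) (k' := fun t : ℝ => k * t ^ (k-1)) h1 (by fun_prop)).Dir hχ
  have hg := green_zonal a (k := fun t : ℝ => t ^ k) (k' := fun t : ℝ => k * t ^ (k-1)) (k'' := fun t : ℝ => (k:ℝ) * (((k-1 : ℕ) : ℝ) * t ^ (k-1-1))) h1 h2 (by fun_prop) hχ
  rw [hd, hg]
  unfold IP
  have hc : ContinuousOn χ S3 := hχ.contG
  rw [← integral_const_mul, ← integral_const_mul, ← integral_sub, ← integral_neg]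
  · congr 1; ext x
    rcases k with _ | _ | k
    · simp
    · simp; ring
    · simp only [Nat.add_sub_cancel, Nat.cast_add, Nat.cast_one]
      have : k + 1 + 1 - 2 = k := by omega
      rw [this]; ring
  · exact (int_mul (CC_pow a k).contG hc).const_mul _
  · exact (int_mul (CC_pow a (k-2)).contG hc).const_mul _

lemma PP_D {N : ℕ} {p : E3 → ℝ} (hp : p ∈ PP N) :
    ∃ q ∈ PP (N - 1), ∀ χ, CC χ → Dir p χ = N * (N + 1) * IP p χ - IP q χ := by
  induction hp using Submodule.span_induction with
  | mem f hf =>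
    obtain ⟨a, k, hk, rfl⟩ := hf
    refine ⟨((N * (N+1) - k * (k+1) : ℝ) • fun x => (inner ℝ a x : ℝ) ^ k) +
      ((k * (k - 1) * inner ℝ a a : ℝ) • fun x => (inner ℝ a x : ℝ) ^ (k - 2)), ?_, fun χ hχ => ?_⟩
    · refine Submodule.add_mem _ ?_ (Submodule.smul_mem _ _ (ppow_mem a (by omega)))
      rcases hk.eq_or_lt with rfl | hlt
      · simp
      · exact Submodule.smul_mem _ _ (ppow_mem a (by omega))
    · rw [Dir_pow a k hχ]
      have e : IP (((N * (N+1) - k * (k+1) : ℝ) • fun x => (inner ℝ a x : ℝ) ^ k) +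
        ((k * (k - 1) * inner ℝ a a : ℝ) • fun x => (inner ℝ a x : ℝ) ^ (k - 2))) χ =
          (N * (N+1) - k * (k+1) : ℝ) * IP (fun x => (inner ℝ a x : ℝ) ^ k) χ +
          (k * (k - 1) * inner ℝ a a : ℝ) * IP (fun x => (inner ℝ a x : ℝ) ^ (k-2)) χ := by
        rw [← IP_smul, ← IP_smul]
        exact IP_add ((CC_pow a k).smul _).contG ((CC_pow a (k-2)).smul _).contG hχ.contG
      rw [e]; ring
  | zero =>
    refine ⟨0, Submodule.zero_mem _, fun χ hχ => ?_⟩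
    have := (C1.const 0).Dir hχ
    rw [show (0 : E3 → ℝ) = fun _ => 0 from rfl, this]
    simp [IP, Gm]
  | add f g hf' hg' hf hg =>
    obtain ⟨q, hq, h1⟩ := hf
    obtain ⟨r, hr, h2⟩ := hg
    refine ⟨q + r, Submodule.add_mem _ hq hr, fun χ hχ => ?_⟩
    have e1 : Dir (f + g) χ = Dir f χ + Dir g χ := Dir_add (PP_CC hf') (PP_CC hg') hχ
    have e2 : IP (f + g) χ = IP f χ + IP g χ := IP_add (PP_CC hf').contG (PP_CC hg').contG hχ.contG
    have e3 : IP (q + r) χ = IP q χ + IP r χ := IP_add (PP_CC hq).contG (PP_CC hr).contG hχ.contG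
    rw [e1, e2, e3, h1 χ hχ, h2 χ hχ]; ring
  | smul c f hf' hf =>
    obtain ⟨q, hq, h1⟩ := hf
    refine ⟨c • q, Submodule.smul_mem _ _ hq, fun χ hχ => ?_⟩
    have e1 : Dir (c • f) χ = c * Dir f χ := Dir_smul c (PP_CC hf') hχ
    have e2 : IP (c • f) χ = c * IP f χ := IP_smul c f χ
    have e3 : IP (c • q) χ = c * IP q χ := IP_smul c q χ
    rw [e1, e2, e3, h1 χ hχ]; ring

/-! ### finite dimensionality -/

def mono3 (i j l : ℕ) : E3 → ℝ := fun x => x 0 ^ i * x 1 ^ j * x 2 ^ l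

lemma PP_fg (N : ℕ) : ∃ s : Finset (E3 → ℝ), (∀ f ∈ s, CC f) ∧ Submodule.span ℝ (s : Set (E3 → ℝ)) = PP N := by
  classical
  let T : Finset (E3 → ℝ) := ((Finset.range (N+1) ×ˢ Finset.range (N+1)) ×ˢ Finset.range (N+1)).image
    fun t => mono3 t.1.1 t.1.2 t.2
  have hle : PP N ≤ Submodule.span ℝ (T : Set (E3 → ℝ)) := by
    refine Submodule.span_le.mpr ?_
    rintro f ⟨a, k, hk, rfl⟩
    have e : (fun x : E3 => (inner ℝ a x : ℝ) ^ k) =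
        ∑ m ∈ Finset.range (k+1), ∑ n ∈ Finset.range (m+1),
          ((a 0 ^ n * a 1 ^ (m - n) * a 2 ^ (k - m) * (m.choose n) * (k.choose m) : ℝ) •
            mono3 n (m-n) (k-m)) := by
      ext x
      rw [inner3, add_pow]
      simp only [Finset.sum_apply, Pi.smul_apply, smul_eq_mul, mono3]
      refine Finset.sum_congr rfl fun m _ => ?_
      rw [add_pow, Finset.sum_mul, Finset.sum_mul]
      refine Finset.sum_congr rfl fun n _ => ?_
      ring
    rw [e]
    refine Submodule.sum_mem _ fun m hm => Submodule.sum_mem _ fun n hn => Submodule.smul_mem _ _ ?_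
    apply Submodule.subset_span
    simp only [Finset.mem_range] at hm hn
    simp only [T, Finset.coe_image, Set.mem_image, Finset.mem_coe, Finset.mem_product, Finset.mem_range]
    exact ⟨((n, m-n), k-m), ⟨⟨by dsimp only; omega, by dsimp only; omega⟩, by dsimp only; omega⟩, rfl⟩
  have hfin : FiniteDimensional ℝ (Submodule.span ℝ (T : Set (E3 → ℝ))) :=
    FiniteDimensional.span_finset ℝ T
  have : FiniteDimensional ℝ (PP N) := Submodule.finiteDimensional_of_le hle
  obtain ⟨s, hs⟩ := (PP N).fg_iff_finiteDimensional.mpr this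
  exact ⟨s, fun f hf => PP_CC (N := N) (hs ▸ Submodule.subset_span hf), hs⟩

lemma IP_span_zero {s : Set (E3 → ℝ)} (hs : ∀ f ∈ s, CC f) {h : E3 → ℝ} (hh : ContinuousOn h S3)
    (h0 : ∀ f ∈ s, IP h f = 0) {p : E3 → ℝ} (hp : p ∈ Submodule.span ℝ s) : CC p ∧ IP h p = 0 := by
  induction hp using Submodule.span_induction with
  | mem f hf => exact ⟨hs f hf, h0 f hf⟩
  | zero => exact ⟨(C1.const 0).CC, by simp [IP]⟩
  | add f g _ _ hf hg =>
    refine ⟨hf.1.add hg.1, ?_⟩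
    have : IP h (f + g) = IP h f + IP h g := IP_add_r hf.1.contG hg.1.contG hh
    rw [this, hf.2, hg.2, add_zero]
  | smul c f _ hf =>
    refine ⟨hf.1.smul c, ?_⟩
    have : IP h (c • f) = c * IP h f := IP_smul_r c f h
    rw [this, hf.2, mul_zero]

lemma proj_finset (s : Finset (E3 → ℝ)) (hs : ∀ f ∈ s, CC f) :
    ∀ f : E3 → ℝ, ContinuousOn f S3 → ∃ w ∈ Submodule.span ℝ (s : Set (E3 → ℝ)),
      ∀ p ∈ s, IP (fun x => f x - w x) p = 0 := by
  classical
  induction s using Finset.induction_on with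
  | empty => exact fun f hf => ⟨0, by simp, by simp⟩
  | insert b s hb ih =>
    have hs' : ∀ f ∈ (s : Set (E3 → ℝ)), CC f := fun f hf => hs f (Finset.mem_insert_of_mem hf)
    have hbC : CC b := hs b (Finset.mem_insert_self _ _)
    specialize ih hs'
    intro f hf
    obtain ⟨w, hw, hw0⟩ := ih f hf
    obtain ⟨d, hd, hd0⟩ := ih b hbC.contG
    have hdC : CC d := (IP_span_zero hs' (h := fun _ => 0) continuousOn_const (by simp [IP]) hd).1
    have hwC : CC w := (IP_span_zero hs' (h := fun _ => 0) continuousOn_const (by simp [IP]) hw).1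
    set b' : E3 → ℝ := fun x => b x - d x with hb'
    have hb'C : CC b' := hbC.sub hdC
    have hfw : ContinuousOn (fun x => f x - w x) S3 := hf.sub hwC.contG
    set c : ℝ := IP (fun x => f x - w x) b' / IP b' b' with hc
    have hsub : Submodule.span ℝ (s : Set (E3 → ℝ)) ≤ Submodule.span ℝ ((insert b s : Finset (E3 → ℝ)) : Set (E3 → ℝ)) :=
      Submodule.span_mono (by simp)
    have key : ∀ p, CC p → IP (fun x => f x - (w + c • b') x) p = IP (fun x => f x - w x) p - c * IP b' p := by
      intro p hp
      rw [← IP_smul, ← IP_sub hfw (hb'C.smul c).contG hp.contG]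
      congr 1; ext x; simp; ring
    have hps : ∀ p ∈ s, IP (fun x => f x - (w + c • b') x) p = 0 := fun p hp => by
      rw [key p (hs' p hp), hw0 p hp, hd0 p hp]; ring
    have hcont : ContinuousOn (fun x => f x - (w + c • b') x) S3 :=
      hf.sub (hwC.add (hb'C.smul c)).contG
    refine ⟨w + c • b', Submodule.add_mem _ (hsub hw) (Submodule.smul_mem _ _
      (Submodule.sub_mem _ (Submodule.subset_span (by simp)) (hsub hd))), ?_⟩
    intro p hp
    rcases Finset.mem_insert.mp hp with rfl | hp
    · have e1 : IP (fun x => f x - (w + c • b') x) p =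
          IP (fun x => f x - (w + c • b') x) b' + IP (fun x => f x - (w + c • b') x) d := by
        rw [← IP_add_r hb'C.contG hdC.contG hcont]
        congr 1; ext x; simp [hb']
      rw [e1, (IP_span_zero hs' hcont hps hd).2, key b' hb'C]
      by_cases h0 : IP b' b' = 0
      · have hz : ∀ x ∈ S3, b' x = 0 := fun x hx => by
          have := int_pos_zero (f := fun x => b' x * b' x) (hb'C.contG.mul hb'C.contG)
            (fun x _ => mul_self_nonneg _) h0.le x hx
          simpa using this
        have : IP (fun x => f x - w x) b' = 0 := by
          rw [IP_congr (fun _ _ => rfl) (k := fun _ => 0) hz]; simp [IP]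
        rw [this, h0]; ring
      · rw [hc]; field_simp; ring
    · exact hps p hp

lemma proj (N : ℕ) {f : E3 → ℝ} (hf : ContinuousOn f S3) :
    ∃ w ∈ PP N, ∀ p ∈ PP N, IP (fun x => f x - w x) p = 0 := by
  obtain ⟨s, hs, e⟩ := PP_fg N
  obtain ⟨w, hw, h⟩ := proj_finset s hs f hf
  rw [e] at hw
  refine ⟨w, hw, fun p hp => ?_⟩
  rw [← e] at hp
  exact (IP_span_zero hs (hf.sub (PP_CC hw).contG) h hp).2

lemma gap_poly (N : ℕ) : ∀ p ∈ PP N, (∀ r ∈ PP 2, IP p r = 0) → 12 * IP p p ≤ Dir p p := by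
  induction N with
  | zero =>
    intro p hp h
    rw [h p (PP_mono (by omega) hp)]; simpa using Dir_self_nonneg p
  | succ N ih =>
    intro p hp h
    rcases Nat.lt_or_ge N 2 with hN | hN
    · rw [h p (PP_mono (by omega) hp)]; simpa using Dir_self_nonneg p
    have hpC := PP_CC hp
    obtain ⟨w, hw, hw0⟩ := proj N hpC.contG
    have hwC := PP_CC hw
    set Y : E3 → ℝ := fun x => p x - w x with hY
    have hYC : CC Y := hpC.sub hwC
    have hYP : Y ∈ PP (N+1) := Submodule.sub_mem _ hp (PP_mono (by omega) hw)
    have ep : p = fun x => Y x + w x := by ext x; simp [hY]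
    have hw2 : ∀ r ∈ PP 2, IP w r = 0 := fun r hr => by
      have h1 := hw0 r (PP_mono hN hr)
      rw [hY, IP_sub hpC.contG hwC.contG (PP_CC hr).contG, h r hr] at h1
      linarith
    have h1 := ih w hw hw2
    obtain ⟨q, hq, hqD⟩ := PP_D hYP
    obtain ⟨q', hq', hqD'⟩ := PP_D hw
    have hYY := hqD Y hYC
    rw [IP_comm q, hw0 q hq] at hYY
    have hwY := hqD' Y hYC
    rw [IP_comm q', hw0 q' (PP_mono (by omega) hq'), IP_comm w, hw0 w hw] at hwY
    have e1 : Dir p p = Dir Y Y + 2 * Dir w Y + Dir w w := by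
      conv_lhs => rw [ep]
      rw [Dir_add hYC hwC (hYC.add hwC), Dir_add_r hYC hwC hYC, Dir_add_r hYC hwC hwC, Dir_comm Y w]; ring
    have e2 : IP p p = IP Y Y + IP w w := by
      conv_lhs => rw [ep]
      rw [IP_add hYC.contG hwC.contG (hYC.add hwC).contG, IP_add_r hYC.contG hwC.contG hYC.contG,
        IP_add_r hYC.contG hwC.contG hwC.contG, IP_comm w Y, hw0 w hw]; ring
    have hNr : (2:ℝ) ≤ N := by exact_mod_cast hN
    have := IP_self_nonneg Y
    have h12 : 12 * IP Y Y ≤ Dir Y Y := by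
      rw [hYY]; push_cast
      nlinarith [mul_nonneg (sub_nonneg.mpr hNr) this, mul_nonneg (mul_nonneg (sub_nonneg.mpr hNr) (by linarith : (0:ℝ) ≤ N)) this]
    rw [e1, e2]; linarith


instance : CompactSpace S3 := isCompact_iff_compactSpace.mp isCompact_S3

def LC (a : E3) : C(S3, ℝ) := ⟨fun x => inner ℝ a x.1, by fun_prop⟩

def WP : Submodule ℝ C(S3, ℝ) := Submodule.span ℝ {f | ∃ (a : E3) (k : ℕ), f = LC a ^ k}

lemma WP_mem {f : C(S3, ℝ)} (hf : f ∈ WP) : ∃ N, ∃ r ∈ PP N, ∀ x : S3, f x = r x := by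
  induction hf using Submodule.span_induction with
  | mem f hf =>
    obtain ⟨a, k, rfl⟩ := hf
    exact ⟨k, _, ppow_mem a le_rfl, fun x => by simp [LC]⟩
  | zero => exact ⟨0, 0, Submodule.zero_mem _, fun x => by simp⟩
  | add f g _ _ hf hg =>
    obtain ⟨N, r, hr, h⟩ := hf
    obtain ⟨M, s, hs, h'⟩ := hg
    exact ⟨max N M, r + s, Submodule.add_mem _ (PP_mono (le_max_left _ _) hr) (PP_mono (le_max_right _ _) hs),
      fun x => by simp [h, h']⟩
  | smul c f _ hf =>
    obtain ⟨N, r, hr, h⟩ := hf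
    exact ⟨N, c • r, Submodule.smul_mem _ _ hr, fun x => by simp [h]⟩

lemma exp_mem_WP (a : E3) : NormedSpace.exp (LC a) ∈ WP.topologicalClosure := by
  have h := NormedSpace.exp_series_hasSum_exp' (𝕂 := ℝ) (LC a)
  refine mem_closure_of_tendsto h (Filter.Eventually.of_forall fun s => ?_)
  exact Submodule.sum_mem _ fun n _ => Submodule.smul_mem _ _ (Submodule.subset_span ⟨a, n, rfl⟩)

def expMon : Submonoid C(S3, ℝ) where
  carrier := {f | ∃ a : E3, f = NormedSpace.exp (LC a)}
  one_mem' := ⟨0, by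
    have : LC 0 = 0 := by ext x; simp [LC]
    rw [this, NormedSpace.exp_zero]⟩
  mul_mem' := by
    rintro _ _ ⟨a, rfl⟩ ⟨b, rfl⟩
    refine ⟨a + b, ?_⟩
    have : LC (a + b) = LC a + LC b := by ext x; simp [LC, inner_add_left]
    rw [this, NormedSpace.exp_add]

lemma exp_eval (a : E3) (x : S3) : (NormedSpace.exp (LC a)) x = Real.exp (inner ℝ a x.1) := by
  have := NormedSpace.map_exp (ContinuousMap.evalAlgHom ℝ ℝ x) (by
    exact continuous_eval_const x) (LC a)
  rw [Real.exp_eq_exp_ℝ]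
  exact this

lemma density {f : E3 → ℝ} (hf : ContinuousOn f S3) {ε : ℝ} (hε : 0 < ε) :
    ∃ N, ∃ r ∈ PP N, ∀ x ∈ S3, |f x - r x| ≤ ε := by
  let A : Subalgebra ℝ C(S3, ℝ) := Algebra.adjoin ℝ (expMon : Set C(S3, ℝ))
  have hA : A.SeparatesPoints := by
    intro x y hxy
    refine ⟨_, ⟨NormedSpace.exp (LC (x.1 - y.1)), Algebra.subset_adjoin ⟨_, rfl⟩, rfl⟩, ?_⟩
    dsimp only
    rw [exp_eval, exp_eval]
    intro h
    have h1 := Real.exp_injective h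
    have h2 : inner ℝ (x.1 - y.1) (x.1 - y.1) = (0:ℝ) := by
      rw [inner_sub_right, h1, sub_self]
    exact hxy (Subtype.ext (sub_eq_zero.mp (inner_self_eq_zero.mp h2)))
  let f' : C(S3, ℝ) := ⟨fun x => f x, continuousOn_iff_continuous_domRestrict.mp hf⟩
  obtain ⟨g, hg⟩ := ContinuousMap.exists_mem_subalgebra_near_continuousMap_of_separatesPoints A hA f' (ε/2) (by positivity)
  have hgW : g.1 ∈ WP.topologicalClosure := by
    have h1 : g.1 ∈ Subalgebra.toSubmodule A := g.2
    rw [Algebra.adjoin_eq_span, Submonoid.closure_eq] at h1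
    refine (Submodule.span_le.mpr ?_) h1
    rintro _ ⟨a, rfl⟩
    exact exp_mem_WP a
  obtain ⟨h, hh, hd⟩ := Metric.mem_closure_iff.mp hgW (ε/2) (by positivity)
  obtain ⟨N, r, hr, e⟩ := WP_mem hh
  refine ⟨N, r, hr, fun x hx => ?_⟩
  rw [← e ⟨x, hx⟩]
  have h1 := ContinuousMap.norm_coe_le_norm (g.1 - f') ⟨x, hx⟩
  have h2 := ContinuousMap.dist_apply_le_dist (f := g.1) (g := h) ⟨x, hx⟩
  rw [Real.dist_eq] at h2
  have h3 : |g.1 ⟨x, hx⟩ - f x| ≤ ‖g.1 - f'‖ := h1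
  have h4 := abs_le.mp (h3.trans hg.le)
  have h5 := abs_le.mp (h2.trans hd.le)
  rw [abs_le]; constructor <;> linarith [h4.1, h4.2, h5.1, h5.2]

/-- Spectral gap: functions orthogonal to polynomials of degree at most two. -/
lemma gap {ξ : E3 → ℝ} (hξ : CC ξ) (h : ∀ r ∈ PP 2, IP ξ r = 0) : 12 * IP ξ ξ ≤ Dir ξ ξ := by
  have key : ∀ ε > 0, 12 * IP ξ ξ ≤ Dir ξ ξ + 12 * (ε ^ 2 * sig.real Set.univ) := by
    intro ε hε
    obtain ⟨N₀, r, hr, hapx⟩ := density hξ.contG hε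
    let N := max N₀ 2
    have hrN : r ∈ PP N := PP_mono (le_max_left _ _) hr
    obtain ⟨w, hw, hw0⟩ := proj N hξ.contG
    have hwC := PP_CC hw
    set Y : E3 → ℝ := fun x => ξ x - w x with hY
    have hYC : CC Y := hξ.sub hwC
    have ep : ξ = fun x => Y x + w x := by ext x; simp [hY]
    have hw2 : ∀ r ∈ PP 2, IP w r = 0 := fun r hr => by
      have h1 := hw0 r (PP_mono (le_max_right _ _) hr)
      rw [hY, IP_sub hξ.contG hwC.contG (PP_CC hr).contG, h r hr] at h1
      linarith
    have h1 := gap_poly N w hw hw2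
    obtain ⟨q', hq', hqD'⟩ := PP_D hw
    have hwY := hqD' Y hYC
    rw [IP_comm q', hw0 q' (PP_mono (by omega) hq'), IP_comm w, hw0 w hw] at hwY
    have e1 : Dir ξ ξ = Dir Y Y + 2 * Dir w Y + Dir w w := by
      conv_lhs => rw [ep]
      rw [Dir_add hYC hwC (hYC.add hwC), Dir_add_r hYC hwC hYC, Dir_add_r hYC hwC hwC, Dir_comm Y w]; ring
    have e2 : IP ξ ξ = IP Y Y + IP w w := by
      conv_lhs => rw [ep]
      rw [IP_add hYC.contG hwC.contG (hYC.add hwC).contG, IP_add_r hYC.contG hwC.contG hYC.contG,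
        IP_add_r hYC.contG hwC.contG hwC.contG, IP_comm w Y, hw0 w hw]; ring
    have h3 := Dir_self_nonneg Y
    have hd : IP Y Y ≤ ε ^ 2 * sig.real Set.univ := by
      have hrC := PP_CC hrN
      set D : E3 → ℝ := fun x => w x - r x with hD
      have hDC : CC D := hwC.sub hrC
      have hYD : IP Y D = 0 := hw0 D (Submodule.sub_mem _ hw hrN)
      have e3 : IP (fun x => Y x + D x) (fun x => Y x + D x) = IP Y Y + IP D D := by
        rw [IP_add hYC.contG hDC.contG (hYC.add hDC).contG, IP_add_r hYC.contG hDC.contG hYC.contG,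
          IP_add_r hYC.contG hDC.contG hDC.contG, IP_comm D Y, hYD]; ring
      have h4 : IP (fun x => Y x + D x) (fun x => Y x + D x) ≤ ∫ _, ε ^ 2 ∂sig := by
        refine int_mono ((hYC.add hDC).contG.mul (hYC.add hDC).contG) continuousOn_const fun x hx => ?_
        have h5 := hapx x hx
        have : Y x + D x = ξ x - r x := by simp [hY, hD]
        simp only [this]
        rw [← sq, ← sq_abs]
        exact pow_le_pow_left₀ (abs_nonneg _) h5 2
      rw [integral_const, smul_eq_mul, mul_comm] at h4
      linarith [IP_self_nonneg D]
    rw [e1, e2, hwY]; linarith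
  by_contra hcon
  push Not at hcon
  have hS : 0 ≤ sig.real Set.univ := measureReal_nonneg
  set δ := 12 * IP ξ ξ - Dir ξ ξ with hδ
  have hδ0 : 0 < δ := by linarith
  have h1 := key (Real.sqrt (δ / (24 * (sig.real Set.univ + 1)))) (Real.sqrt_pos.mpr (by positivity))
  rw [Real.sq_sqrt (by positivity)] at h1
  have h2 : 12 * (δ / (24 * (sig.real Set.univ + 1)) * sig.real Set.univ) ≤ δ / 2 := by
    have : 12 * (δ / (24 * (sig.real Set.univ + 1)) * sig.real Set.univ) = δ/2 * (sig.real Set.univ / (sig.real Set.univ + 1)) := by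
      field_simp; ring
    rw [this]
    have h3 : sig.real Set.univ / (sig.real Set.univ + 1) ≤ 1 := by
      rw [div_le_one (by positivity)]; linarith
    nlinarith
  linarith


structure Sol (lam : ℝ) (F : E3 → ℝ) (G : E3 → E3) (H : E3 → E3 →L[ℝ] E3) : Prop where
  c2 : C2 F G H
  rad : ∀ x ∈ S3, inner ℝ x (G x) = (0:ℝ)
  Hx : ∀ x ∈ S3, H x x = - G x
  sym : ∀ x ∈ S3, ∀ a b, inner ℝ (H x a) b = (inner ℝ a (H x b) : ℝ)
  we : ∀ χ, CC χ → Dir F χ = IP (fun x => lam * (Real.exp (F x) - 1)) χ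
  bd : ∀ x ∈ S3, lam * Real.exp (F x) ≤ 12
  two : 2 < lam

namespace Sol
variable {lam : ℝ} {F : E3 → ℝ} {G : E3 → E3} {H : E3 → E3 →L[ℝ] E3}

lemma CCF (h : Sol lam F G H) : CC F := h.c2.c1.CC
lemma cF (h : Sol lam F G H) : ContinuousOn F S3 := h.c2.c1.contG
lemma cG (h : Sol lam F G H) : ContinuousOn G S3 := h.c2.c1.cont
lemma cexp (h : Sol lam F G H) : ContinuousOn (fun x => Real.exp (F x)) S3 :=
  Real.continuous_exp.comp_continuousOn h.cF

lemma Dir_compR {f χ : E3 → ℝ} (hf : CC f) (hχ : CC χ) (R : E3 ≃ₗᵢ[ℝ] E3) :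
    Dir (fun x => f (R x)) χ = Dir f (fun x => χ (R.symm x)) := by
  rw [(C1.compR hf R).Dir hχ, C1.Dir hf (C1.compR hχ R.symm)]
  rw [← integral_comp_R R (fun x => Gm x (gradient f x) (R.symm.symm (gradient χ (R.symm x))))]
  congr 1; ext x
  rw [Gm_R]; simp

lemma IP_compR (f χ : E3 → ℝ) (R : E3 ≃ₗᵢ[ℝ] E3) :
    IP (fun x => f (R x)) χ = IP f (fun x => χ (R.symm x)) := by
  unfold IP
  rw [← integral_comp_R R (fun x => f x * χ (R.symm x))]
  simp

lemma compR (h : Sol lam F G H) (R : E3 ≃ₗᵢ[ℝ] E3) :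
    Sol lam (fun x => F (R x)) (fun x => R.symm (G (R x)))
      (fun x => (R.symm.toContinuousLinearEquiv : E3 →L[ℝ] E3) ∘L (H (R x)) ∘L (R.toContinuousLinearEquiv : E3 →L[ℝ] E3)) where
  c2 := by
    refine ⟨h.c2.c1.compR R, fun x hx => ?_, ?_⟩
    · exact (R.symm.toContinuousLinearEquiv.hasFDerivAt (x := G (R x))).comp x
        ((h.c2.der _ (R_mem R hx)).comp x (R.toContinuousLinearEquiv.hasFDerivAt (x := x)))
    · have h1 : ContinuousOn (fun x => H (R x)) S3 :=
        h.c2.cont.comp R.continuous.continuousOn fun x hx => R_mem R hx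
      exact continuousOn_const.clm_comp (h1.clm_comp continuousOn_const)
  rad x hx := by
    have h1 := R.inner_map_map x (R.symm (G (R x)))
    rw [← h1, R.apply_symm_apply]
    exact h.rad _ (R_mem R hx)
  Hx x hx := by
    simp only [ContinuousLinearMap.comp_apply]
    have := h.Hx _ (R_mem R hx)
    simp [this]
  sym x hx a b := by
    simp only [ContinuousLinearMap.comp_apply]
    have h1 := R.inner_map_map (R.symm (H (R x) (R a))) b
    have h2 := R.inner_map_map a (R.symm (H (R x) (R b)))
    rw [R.apply_symm_apply] at h1 h2
    have h3 := h.sym _ (R_mem R hx) (R a) (R b)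
    have : inner ℝ (R.symm (H (R x) (R a))) b = (inner ℝ a (R.symm (H (R x) (R b))) : ℝ) := by
      rw [← h1, ← h2, h3]
    exact this
  we χ hχ := by
    rw [Dir_compR h.CCF hχ, h.we _ (C1.compR hχ R.symm).CC,
      ← IP_compR (fun x => lam * (Real.exp (F x) - 1)) χ R]
  bd x hx := h.bd _ (R_mem R hx)
  two := h.two

lemma Dir_lin (a : E3) {χ : E3 → ℝ} (hχ : CC χ) :
    Dir (fun x => inner ℝ a x) χ = 2 * IP (fun x => inner ℝ a x) χ := by
  have := Dir_pow a 1 hχ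
  simp only [pow_one] at this
  rw [this]; norm_num

lemma int_lin (a : E3) : ∫ x, (inner ℝ a x : ℝ) ∂sig = 0 := by
  have h1 := Dir_lin a (C1.const 1).CC
  rw [C1.Dir (C1.lin a) (C1.const 1)] at h1
  simp [Gm, IP] at h1
  exact h1

lemma C1_normsq (h : Sol lam F G H) : C1 (fun x => inner ℝ (G x) (G x)) (fun x => (2:ℝ) • H x (G x)) := by
  refine ⟨by have := h.c2.cont.clm_apply h.cG; exact this.const_smul (2:ℝ), fun x hx => ?_⟩
  refine ((h.c2.der x hx).inner ℝ (h.c2.der x hx)).congr_fderiv ?_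
  ext v
  simp only [ContinuousLinearMap.comp_apply, innerSL_apply_apply, fderivInnerCLM_apply, 
      ContinuousLinearMap.prod_apply, inner_smul_left, conj_trivial]
  rw [real_inner_comm (G x), h.sym x hx (G x) v]; ring

lemma C1_part (h : Sol lam F G H) (a : E3) : C1 (fun x => inner ℝ (G x) a) (fun x => H x a) := by
  refine ⟨h.c2.cont.clm_apply continuousOn_const, fun x hx => ?_⟩
  refine ((h.c2.der x hx).inner ℝ (hasFDerivAt_const a x)).congr_fderiv ?_
  ext v
  simp only [ContinuousLinearMap.comp_apply, innerSL_apply_apply, fderivInnerCLM_apply, 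
      ContinuousLinearMap.prod_apply, zero_apply, inner_zero_right, zero_add]
  rw [h.sym x hx v a, real_inner_comm]

lemma kw (h : Sol lam F G H) (a : E3) : IP F (fun x => inner ℝ a x) = 0 := by
  have hla : CC (fun x => inner ℝ a x) := (C1.lin a).CC
  have hn := h.C1_normsq
  have h1 : Dir F (fun x => inner ℝ (G x) a) = 0 := by
    rw [C1.Dir h.c2.c1 (h.C1_part a)]
    have h2 := Dir_lin a hn.CC
    rw [C1.Dir (C1.lin a) hn] at h2
    unfold IP at h2
    have h3 : ∫ x, Gm x (G x) (H x a) ∂sig = (1/2) * ∫ x, Gm x a ((2:ℝ) • H x (G x)) ∂sig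
        - ∫ x, inner ℝ a x * inner ℝ (G x) (G x) ∂sig := by
      rw [← integral_const_mul, ← integral_sub]
      · refine int_congr fun x hx => ?_
        have e1 : inner ℝ x (H x (G x)) = - (inner ℝ (G x) (G x) : ℝ) := by
          rw [← h.sym x hx, h.Hx x hx, inner_neg_left]
        simp only [Gm, h.rad x hx, inner_smul_right, e1]
        rw [← h.sym x hx (G x) a, real_inner_comm a (H x (G x)), real_inner_comm a x]; ring
      · exact (int_cont (cont_Gm continuousOn_const hn.cont)).const_mul _
      · exact int_mul hla.contG hn.contG
    rw [h3, h2]; ring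
  have h2 := h.we _ (h.C1_part a).CC
  rw [h1] at h2
  have hK : C1 (fun x => Real.exp (F x) - F x) (fun x => Real.exp (F x) • G x - G x) := h.c2.c1.exp.sub h.c2.c1
  have h3 : Dir (fun x => inner ℝ a x) (fun x => Real.exp (F x) - F x) = 0 := by
    have : lam * Dir (fun x => inner ℝ a x) (fun x => Real.exp (F x) - F x) = 0 := by
      rw [h2, C1.Dir (C1.lin a) hK, ← integral_const_mul]
      refine int_congr fun x hx => ?_
      simp only [Gm, inner_sub_right, inner_smul_right, h.rad x hx]
      rw [real_inner_comm]; ring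
    have hl := h.two
    exact (mul_eq_zero.mp this).resolve_left (by linarith)
  rw [Dir_lin a hK.CC, IP_sub_r h.cexp h.cF hla.contG] at h3
  have h4 := h.we _ hla
  rw [Dir_comm, Dir_lin a h.CCF] at h4
  have h5 : IP (fun x => lam * (Real.exp (F x) - 1)) (fun x => inner ℝ a x) = lam * IP (fun x => inner ℝ a x) (fun x => Real.exp (F x)) := by
    rw [IP_smul, IP_sub h.cexp continuousOn_const hla.contG, IP_comm]
    have : IP (fun _ => (1:ℝ)) (fun x => inner ℝ a x) = 0 := by simp [IP, int_lin]
    rw [this, sub_zero]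
  rw [h5] at h4
  have h6 : (lam - 2) * IP (fun x => inner ℝ a x) F = 0 := by linear_combination - (1/2) * lam * h3 - h4
  have hl := h.two
  rw [IP_comm]
  exact (mul_eq_zero.mp h6).resolve_left (by linarith)

/-- diagonalization -/
def QF (F : E3 → ℝ) (a b : E3) : ℝ := ∫ x, F x * inner ℝ a x * inner ℝ b x ∂sig

lemma exists_diag {F : E3 → ℝ} (hF : ContinuousOn F S3) : ∃ R : E3 ≃ₗᵢ[ℝ] E3, ∀ i j, i ≠ j → QF (fun x => F (R x)) (ee i) (ee j) = 0 := by
  have hc : ∀ a : E3, Integrable (fun x => (F x * (inner ℝ a x : ℝ)) • x) sig := fun a =>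
    int_cont ((hF.mul (by fun_prop)).smul continuousOn_id)
  let T : E3 →ₗ[ℝ] E3 :=
    { toFun := fun a => ∫ x, (F x * (inner ℝ a x : ℝ)) • x ∂sig
      map_add' := fun a b => by
        rw [← integral_add (hc a) (hc b)]
        congr 1; ext1 x; rw [inner_add_left, mul_add, add_smul]
      map_smul' := fun c a => by
        rw [RingHom.id_apply, ← integral_smul]
        congr 1; ext1 x; rw [inner_smul_left, smul_smul]; congr 1; simp; ring }
  have hT : ∀ a b, inner ℝ (T a) b = QF F a b := fun a b => by
    rw [real_inner_comm]
    change inner ℝ b (∫ x, (F x * (inner ℝ a x : ℝ)) • x ∂sig) = _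
    rw [← integral_inner (hc a)]
    unfold QF
    simp only [inner_smul_right]
  have hsymm : T.IsSymmetric := fun a b => by
    rw [hT, real_inner_comm, hT]
    unfold QF
    congr 1; ext x; ring
  let b := hsymm.eigenvectorBasis (n := 3) (by simp)
  refine ⟨b.repr.symm, fun i j hij => ?_⟩
  have e : ∀ k, b.repr.symm (ee k) = b k := fun k => by simp [ee]
  have h1 : QF (fun x => F (b.repr.symm x)) (ee i) (ee j) = QF F (b i) (b j) := by
    unfold QF
    rw [← integral_comp_R b.repr.symm (fun x => F x * inner ℝ (b i) x * inner ℝ (b j) x)]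
    congr 1; ext x
    rw [← e i, ← e j, LinearIsometryEquiv.inner_map_map, LinearIsometryEquiv.inner_map_map]
  rw [h1, ← hT, hsymm.apply_eigenvectorBasis]
  have : inner ℝ (b i) (b j) = (0:ℝ) := b.orthonormal.2 hij
  rw [inner_smul_left, this, mul_zero]

/-- coordinate reflection -/
def refl (i : Fin 3) : E3 ≃ₗᵢ[ℝ] E3 := (ℝ ∙ (ee i))ᗮ.reflection

lemma refl_apply (i : Fin 3) (x : E3) : refl i x = x - (2 * x i) • ee i := by
  unfold refl
  rw [Submodule.reflection_orthogonal_apply, Submodule.reflection_singleton_apply]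
  simp only [inner_ee]
  simp [ee, two_smul]
  module

lemma refl_coord (i j : Fin 3) (x : E3) : refl i x j = if i = j then - x j else x j := by
  rw [refl_apply]
  by_cases h : i = j
  · subst h; simp [ee]; ring
  · simp [ee, h, Ne.symm h]

lemma refl_refl (i : Fin 3) (x : E3) : refl i (refl i x) = x := by
  simp [refl]

lemma refl_symm (i : Fin 3) (x : E3) : (refl i).symm x = refl i x := by
  rw [LinearIsometryEquiv.symm_apply_eq, refl_refl]

lemma inner_refl (i : Fin 3) (a x : E3) : inner ℝ a (refl i x) = (inner ℝ (refl i a) x : ℝ) := by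
  rw [← (refl i).inner_map_map a, refl_refl]

lemma expineq {l a b : ℝ} (ha : l * Real.exp a ≤ 12) (hb : l * Real.exp b ≤ 12) (hl : 0 < l) :
    0 ≤ 12 * (a - b) ^ 2 - l * (Real.exp a - Real.exp b) * (a - b) ∧
    (12 * (a - b) ^ 2 - l * (Real.exp a - Real.exp b) * (a - b) = 0 → a = b) := by
  wlog hab : a ≤ b generalizing a b
  · have := this hb ha (by linarith)
    refine ⟨?_, fun h => (this.2 ?_).symm⟩
    · have := this.1; nlinarith
    · linarith
  rcases hab.eq_or_lt with rfl | hlt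
  · simp
  -- exp b - exp a < exp b (b-a)
  have h1 : Real.exp b - Real.exp a < Real.exp b * (b - a) := by
    have := Real.add_one_lt_exp (x := a - b) (by linarith)
    have e : Real.exp a = Real.exp b * Real.exp (a - b) := by rw [← Real.exp_add]; ring_nf
    rw [e]; nlinarith [Real.exp_pos b]
  have h2 : l * (Real.exp b - Real.exp a) < 12 * (b - a) := by
    calc _ < l * (Real.exp b * (b-a)) := by gcongr
      _ = (l * Real.exp b) * (b-a) := by ring
      _ ≤ _ := by gcongr
  have h3 : 0 < 12 * (a - b) ^ 2 - l * (Real.exp a - Real.exp b) * (a - b) := by nlinarith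
  exact ⟨h3.le, fun h => absurd h h3.ne'⟩

lemma even (h : Sol lam F G H) (hd : ∀ i j, i ≠ j → QF F (ee i) (ee j) = 0) (i : Fin 3) :
    ∀ x ∈ S3, F (refl i x) = F x := by
  have hR := h.compR (refl i)
  set v : E3 → ℝ := fun x => F x - F (refl i x) with hv
  have hvC : CC v := h.CCF.sub hR.CCF
  have hl := h.two
  have hq : ∀ a, QF F a a = a 0 ^ 2 * QF F (ee 0) (ee 0) + a 1 ^ 2 * QF F (ee 1) (ee 1) + a 2 ^ 2 * QF F (ee 2) (ee 2) := by
    intro a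
    have hIntg : ∀ c d : E3, Integrable (fun x => F x * inner ℝ c x * inner ℝ d x) sig := fun c d =>
      int_mul (h.cF.mul (by fun_prop)) (by fun_prop)
    have e : QF F a a = a 0 ^ 2 * QF F (ee 0) (ee 0) + a 1 ^ 2 * QF F (ee 1) (ee 1) + a 2 ^ 2 * QF F (ee 2) (ee 2)
        + 2 * a 0 * a 1 * QF F (ee 0) (ee 1) + 2 * a 1 * a 2 * QF F (ee 1) (ee 2) + 2 * a 0 * a 2 * QF F (ee 0) (ee 2) := by
      unfold QF
      simp only [← integral_const_mul]
      have hI : ∀ (k : ℝ) (c d : E3), Integrable (fun x => k * (F x * inner ℝ c x * inner ℝ d x)) sig :=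
        fun k c d => (hIntg c d).const_mul k
      rw [← integral_add (hI _ _ _) (hI _ _ _), ← integral_add ?_ (hI _ _ _), ← integral_add ?_ (hI _ _ _),
        ← integral_add ?_ (hI _ _ _), ← integral_add ?_ (hI _ _ _)]
      · congr 1; ext x
        simp only [inner_ee]; rw [inner3]; ring
      · exact (((((hI _ _ _).add (hI _ _ _)).add (hI _ _ _)).add (hI _ _ _)).add (hI _ _ _))
      · exact ((((hI _ _ _).add (hI _ _ _)).add (hI _ _ _)).add (hI _ _ _))
      · exact (((hI _ _ _).add (hI _ _ _)).add (hI _ _ _))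
      · exact ((hI _ _ _).add (hI _ _ _))
    rw [e, hd 0 1 (by decide), hd 1 2 (by decide), hd 0 2 (by decide)]; ring
  have horth : ∀ r ∈ PP 2, IP v r = 0 := by
    intro r hr
    refine (IP_span_zero ?_ hvC.contG ?_ hr).2
    · rintro _ ⟨a, k, _, rfl⟩; exact CC_pow a k
    · rintro _ ⟨a, k, hk, rfl⟩
      rw [hv, IP_sub h.cF hR.cF (CC_pow a k).contG, IP_compR F]
      simp only [refl_symm, inner_refl]
      interval_cases k
      · simp
      · simp only [pow_one]
        rw [h.kw, h.kw, sub_self]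
      · have e : ∀ a : E3, IP F (fun x => (inner ℝ a x : ℝ) ^ 2) = QF F a a := fun a => by
          unfold IP QF; congr 1; ext x; ring
        rw [e, e, hq, hq (refl i a), refl_coord, refl_coord, refl_coord]
        split_ifs <;> ring
  have hg := gap hvC horth
  have hD : Dir v v = IP (fun x => lam * (Real.exp (F x) - Real.exp (F (refl i x)))) v := by
    have : Dir v v = Dir F v - Dir (fun x => F (refl i x)) v := Dir_sub h.CCF hR.CCF hvC
    rw [this, h.we v hvC, hR.we v hvC, ← IP_sub _ _ hvC.contG]
    · congr 1; ext x; ring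
    · exact continuousOn_const.mul (h.cexp.sub continuousOn_const)
    · exact continuousOn_const.mul (hR.cexp.sub continuousOn_const)
  have hcont : ContinuousOn (fun x => 12 * v x ^ 2 - lam * (Real.exp (F x) - Real.exp (F (refl i x))) * v x) S3 :=
    (continuousOn_const.mul (hvC.contG.pow 2)).sub
      ((continuousOn_const.mul (h.cexp.sub hR.cexp)).mul hvC.contG)
  have hz := int_pos_zero hcont (fun x hx => (expineq (h.bd x hx) (hR.bd x hx) (by linarith)).1) (by
    rw [integral_sub, integral_const_mul]
    · have e1 : IP v v = ∫ x, v x ^ 2 ∂sig := by unfold IP; congr 1; ext x; ring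
      rw [hD, e1] at hg
      unfold IP at hg
      linarith
    · exact (int_cont (hvC.contG.pow 2)).const_mul _
    · exact int_mul (continuousOn_const.mul (h.cexp.sub hR.cexp)) hvC.contG)
  intro x hx
  exact ((expineq (h.bd x hx) (hR.bd x hx) (by linarith)).2 (hz x hx)).symm

end Sol


namespace Sol
variable {lam : ℝ} {F : E3 → ℝ} {G : E3 → E3} {H : E3 → E3 →L[ℝ] E3}

def ph (G : E3 → E3) (p q : E3) : E3 → ℝ := fun x => inner ℝ (G x) (Jm p q x)

lemma C1_ph (h : Sol lam F G H) (p q : E3) : C1 (ph G p q)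
    (fun x => H x (Jm p q x) - Jm p q (G x)) := by
  refine (h.c2.X p q).congr' fun x hx => ?_
  congr 1
  refine ext_inner_right ℝ fun v => ?_
  rw [ContinuousLinearMap.adjoint_inner_left, h.sym x hx]

lemma CC_ph (h : Sol lam F G H) (p q : E3) : CC (ph G p q) := (h.C1_ph p q).CC

lemma weq (h : Sol lam F G H) {p q : E3} (hpq : ON2 p q) {χ : E3 → ℝ} (hχ : CC χ) :
    Dir (ph G p q) χ = IP (fun x => lam * Real.exp (F x) * ph G p q x) χ := by
  set c := gradient χ with hc
  have hcc : ContinuousOn c S3 := C1.cont hχ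
  let I : E3 → (E3 → ℝ) → ℝ → ℝ := fun v K θ => ∫ x, inner ℝ (G (rot hpq θ x)) v * K x ∂sig
  have hI : ∀ v K, ContinuousOn K S3 → HasDerivAt (I v K) (∫ x, inner ℝ (H x v) (Jm p q x) * K x ∂sig) 0 :=
    fun v K hK => flow_deriv hpq (h.C1_part v) hK
  have hin : ∀ v : E3, ContinuousOn (fun x => (inner ℝ v (c x) : ℝ)) S3 := fun v => continuousOn_const.inner hcc
  have hIntg : ∀ (v w : E3) θ, Integrable (fun x => inner ℝ (G (rot hpq θ x)) v * (inner ℝ w (c x) : ℝ)) sig := fun v w θ => by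
    refine int_mul (ContinuousOn.inner ?_ continuousOn_const) (hin w)
    exact h.cG.comp (rot hpq θ).continuous.continuousOn fun x hx => R_mem _ hx
  have key : ∀ θ, I (ee 0) (fun x => inner ℝ (ee 0) (c x)) θ + I (ee 1) (fun x => inner ℝ (ee 1) (c x)) θ
      + I (ee 2) (fun x => inner ℝ (ee 2) (c x)) θ + (cos θ - 1) * I p (fun x => inner ℝ p (c x)) θ
      + (- sin θ) * I p (fun x => inner ℝ q (c x)) θ + sin θ * I q (fun x => inner ℝ p (c x)) θ
      + (cos θ - 1) * I q (fun x => inner ℝ q (c x)) θ =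
      ∫ x, (fun x => lam * (Real.exp (F x) - 1)) (rot hpq θ x) * χ x ∂sig := by
    intro θ
    have h1 := (h.compR (rot hpq θ)).we χ hχ
    rw [C1.Dir (h.compR (rot hpq θ)).c2.c1 hχ] at h1
    refine Eq.trans ?_ h1
    simp only [I]
    rw [← integral_const_mul, ← integral_const_mul, ← integral_const_mul, ← integral_const_mul,
      ← integral_add (hIntg _ _ _) (hIntg _ _ _), ← integral_add ?_ (hIntg _ _ _),
      ← integral_add ?_ ((hIntg _ _ _).const_mul _), ← integral_add ?_ ((hIntg _ _ _).const_mul _),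
      ← integral_add ?_ ((hIntg _ _ _).const_mul _), ← integral_add ?_ ((hIntg _ _ _).const_mul _)]
    · refine int_congr fun x hx => ?_
      have e1 := (h.compR (rot hpq θ)).rad x hx
      unfold Gm
      rw [e1, zero_mul, sub_zero]
      have e2 := (rot hpq θ).inner_map_map ((rot hpq θ).symm (G (rot hpq θ x))) (c x)
      rw [LinearIsometryEquiv.apply_symm_apply] at e2
      rw [← e2]
      conv_rhs => rw [rot_apply hpq θ (c x)]
      simp only [inner_add_right, inner_smul_right]
      rw [inner3 (G (rot hpq θ x)) (c x)]
      simp only [inner_ee, inner_ee']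
      ring
    all_goals repeat' first | exact hIntg _ _ _ | exact (hIntg _ _ _).const_mul _ | refine Integrable.add ?_ ?_
  have hder1 := ((((((hI (ee 0) _ (hin (ee 0))).fun_add (hI (ee 1) _ (hin (ee 1)))).fun_add (hI (ee 2) _ (hin (ee 2)))).fun_add
    (((hasDerivAt_cos 0).sub_const 1).fun_mul (hI p _ (hin p)))).fun_add
    ((hasDerivAt_sin 0).fun_neg.fun_mul (hI p _ (hin q)))).fun_add
    ((hasDerivAt_sin 0).fun_mul (hI q _ (hin p)))).fun_add
    (((hasDerivAt_cos 0).sub_const 1).fun_mul (hI q _ (hin q)))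
  have hE : C1 (fun x => lam * (Real.exp (F x) - 1)) (fun x => lam • (Real.exp (F x) • G x - 0)) :=
    (h.c2.c1.exp.sub (C1.const 1)).smul lam
  have hder2 := flow_deriv hpq hE (K := χ) hχ.contG
  rw [← funext key] at hder2
  have hfin := hder1.unique hder2
  simp only [cos_zero, sin_zero, neg_zero, zero_mul, sub_self, add_zero, zero_add, one_mul, neg_mul] at hfin
  rw [C1.Dir (h.C1_ph p q) hχ]
  have hH : ∀ v w : E3, Integrable (fun x => inner ℝ (H x v) (Jm p q x) * (inner ℝ w (c x) : ℝ)) sig := fun v w =>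
    int_mul ((h.c2.cont.clm_apply continuousOn_const).inner (continuous_Jm p q).continuousOn) (hin w)
  have hI0 : ∀ (v w : E3), I v (fun x => inner ℝ w (c x)) 0 = ∫ x, inner ℝ (G x) v * (inner ℝ w (c x) : ℝ) ∂sig := fun v w => by
    simp only [I, rot_zero]
  have hG0 : ∀ v w : E3, Integrable (fun x => inner ℝ (G x) v * (inner ℝ w (c x) : ℝ)) sig := fun v w => by
    have := hIntg v w 0; simpa only [rot_zero] using this
  have hGn : ∀ v w : E3, Integrable (fun x => -(inner ℝ (G x) v * (inner ℝ w (c x) : ℝ))) sig := fun v w => (hG0 v w).neg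
  rw [hI0, hI0, ← integral_neg, ← integral_add (hH _ _) (hH _ _), ← integral_add ?_ (hH _ _),
    ← integral_add ?_ (hGn _ _), ← integral_add ?_ (hG0 _ _)] at hfin
  · have e3 : ∫ x, inner ℝ (lam • (Real.exp (F x) • G x - 0)) (Jm p q x) * χ x ∂sig = IP (fun x => lam * Real.exp (F x) * ph G p q x) χ := by
      unfold IP ph
      congr 1; ext x
      simp [inner_smul_left, mul_assoc]
    rw [← e3, ← hfin]
    refine int_congr fun x hx => ?_
    have r0 : inner ℝ x (H x (Jm p q x) - Jm p q (G x)) = (0:ℝ) := by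
      rw [inner_sub_right, ← h.sym x hx, h.Hx x hx, inner_neg_left, Jm_skew p q x (G x), real_inner_comm]; ring
    unfold Gm
    rw [r0, zero_mul, sub_zero, inner_sub_left, ← neg_neg (inner ℝ (Jm p q (G x)) (gradient χ x)), ← Jm_skew]
    rw [h.sym x hx (ee 0) (Jm p q x), h.sym x hx (ee 1) (Jm p q x), h.sym x hx (ee 2) (Jm p q x)]
    rw [inner3 (H x (Jm p q x))]
    simp only [inner_ee]
    simp only [Jm, inner_sub_right, inner_smul_right, ← hc]
    ring
  all_goals repeat' first | exact hH _ _ | exact hGn _ _ | refine Integrable.add ?_ ?_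

end Sol


structure EP (f φ : E3 → ℝ) (j k : Fin 3) : Prop where
  jk : j ≠ k
  cc : CC φ
  cf : ContinuousOn f S3
  f0 : ∀ x ∈ S3, 0 < f x
  f12 : ∀ x ∈ S3, f x ≤ 12
  fz : ∀ x ∈ S3, f x = 12 → φ x = 0
  w : ∀ χ, CC χ → Dir φ χ = IP (fun x => f x * φ x) χ
  oj : ∀ x ∈ S3, φ (Sol.refl j x) = - φ x
  ok : ∀ x ∈ S3, φ (Sol.refl k x) = - φ x
  ej : ∀ x ∈ S3, f (Sol.refl j x) = f x
  ek : ∀ x ∈ S3, f (Sol.refl k x) = f x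

namespace Sol
variable {lam : ℝ} {F : E3 → ℝ} {G : E3 → E3} {H : E3 → E3 →L[ℝ] E3}

lemma F_der (h : Sol lam F G H) {p q : E3} (hpq : ON2 p q) {x : E3} (hx : x ∈ S3) (θ : ℝ) :
    HasDerivAt (fun θ => F (rot hpq θ x)) (ph G p q (rot hpq θ x)) θ := by
  have := (h.c2.c1.der _ (R_mem (rot hpq θ) hx)).comp_hasDerivAt θ (rot_deriv hpq θ x)
  simpa [ph, Function.comp_def] using this

lemma rot_refl {j k : Fin 3} (hjk : j ≠ k) (i : Fin 3) (hi : i = j ∨ i = k) (θ : ℝ) (x : E3) :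
    rot (ON2_ee hjk) θ (refl i x) = refl i (rot (ON2_ee hjk) (-θ) x) := by
  ext l
  rw [refl_coord, rot_apply, rot_apply]
  simp only [PiLp.add_apply, PiLp.smul_apply, inner_ee, refl_coord, smul_eq_mul, cos_neg, sin_neg]
  rcases hi with rfl | rfl
  · by_cases h1 : i = l
    · subst h1; simp [ee, hjk]; ring
    · by_cases h2 : k = l
      · subst h2; simp [ee, hjk, hjk.symm]
      · simp [ee, h1, h2, Ne.symm h1, Ne.symm h2]
  · by_cases h1 : i = l
    · subst h1; simp [ee, hjk, hjk.symm]; ring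
    · by_cases h2 : j = l
      · subst h2; simp [ee, hjk, hjk.symm]
      · simp [ee, h1, h2, Ne.symm h1, Ne.symm h2]

lemma odd (h : Sol lam F G H) (he : ∀ i, ∀ x ∈ S3, F (refl i x) = F x) {j k : Fin 3} (hjk : j ≠ k)
    (i : Fin 3) (hi : i = j ∨ i = k) : ∀ x ∈ S3, ph G (ee j) (ee k) (refl i x) = - ph G (ee j) (ee k) x := by
  intro x hx
  have h1 := h.F_der (ON2_ee hjk) (R_mem (refl i) hx) 0
  have h2 := (h.F_der (ON2_ee hjk) hx (-0)).comp (0:ℝ) (hasDerivAt_neg (0:ℝ))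
  have e : (fun θ => F (rot (ON2_ee hjk) θ (refl i x))) = (fun θ => F (rot (ON2_ee hjk) θ x)) ∘ Neg.neg := by
    ext θ
    simp only [Function.comp]
    rw [rot_refl hjk i hi, he i _ (R_mem _ hx)]
  rw [e] at h1
  have := h1.unique h2
  simpa [rot_zero] using this

lemma max_zero (h : Sol lam F G H) {p q : E3} (hpq : ON2 p q) {x : E3} (hx : x ∈ S3)
    (hm : lam * Real.exp (F x) = 12) : ph G p q x = 0 := by
  have h1 := h.F_der hpq hx 0
  rw [rot_zero] at h1
  refine IsLocalMax.hasDerivAt_eq_zero (Filter.Eventually.of_forall fun θ => ?_) h1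
  have h2 := h.bd _ (R_mem (rot hpq θ) hx)
  have h3 := h.two
  rw [← hm] at h2
  simp only [rot_zero]
  exact Real.exp_le_exp.mp (le_of_mul_le_mul_left h2 (by linarith))

lemma EP (h : Sol lam F G H) (he : ∀ i, ∀ x ∈ S3, F (refl i x) = F x) {j k : Fin 3} (hjk : j ≠ k) :
    EP (fun x => lam * Real.exp (F x)) (ph G (ee j) (ee k)) j k where
  jk := hjk
  cc := h.CC_ph _ _
  cf := continuousOn_const.mul h.cexp
  f0 x _ := mul_pos (by linarith [h.two]) (Real.exp_pos _)
  f12 := h.bd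
  fz x hx := h.max_zero (ON2_ee hjk) hx
  w χ hχ := h.weq (ON2_ee hjk) hχ
  oj := h.odd he hjk j (Or.inl rfl)
  ok := h.odd he hjk k (Or.inr rfl)
  ej x hx := by rw [he j x hx]
  ek x hx := by rw [he k x hx]

/-- trilinear identity -/
lemma trilin (h : Sol lam F G H) {p q a b c d : E3} (hpq : ON2 p q) (hab : ON2 a b) (hcd : ON2 c d) :
    ∫ x, lam * Real.exp (F x) * ph G p q x * ph G a b x * ph G c d x ∂sig = 0 := by
  set f : E3 → ℝ := fun x => lam * Real.exp (F x) with hf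
  have hf1 : C1 f (fun x => lam • (Real.exp (F x) • G x)) := h.c2.c1.exp.smul lam
  have h3 := h.C1_ph a b
  have h1 := h.C1_ph c d
  have key : ∀ θ, ∫ x, (fun x => f x * ph G a b x) (rot hpq θ x) * ph G c d x ∂sig =
      ∫ x, ph G a b (rot hpq θ x) * (f x * ph G c d x) ∂sig := by
    intro θ
    have e1 := Dir_compR h3.CC h1.CC (rot hpq θ)
    rw [h.weq hab (C1.compR h1 (rot hpq θ).symm).CC, ← IP_compR (fun x => lam * Real.exp (F x) * ph G a b x) _ (rot hpq θ),
      Dir_comm, h.weq hcd (C1.compR h3 (rot hpq θ)).CC, IP_comm] at e1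
    exact e1.symm
  have d1 := flow_deriv hpq (hf1.mul h3) (K := ph G c d) h1.contG
  have d2 := flow_deriv hpq h3 (K := fun x => f x * ph G c d x) (hf1.contG.mul h1.contG)
  rw [funext key] at d1
  have := d1.unique d2
  rw [← sub_eq_zero, ← integral_sub] at this
  · rw [← this]
    refine int_congr fun x hx => ?_
    simp only [inner_add_left, inner_smul_left, conj_trivial]
    have : ph G p q x = inner ℝ (G x) (Jm p q x) := rfl
    rw [this]; ring
  · exact int_mul ((hf1.mul h3).cont.inner (continuous_Jm p q).continuousOn) h1.contG
  · exact int_mul (h3.cont.inner (continuous_Jm p q).continuousOn) (hf1.contG.mul h1.contG)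

end Sol

namespace EP
variable {f φ : E3 → ℝ} {j k : Fin 3}

lemma neg (h : EP f φ j k) : EP f (fun x => - φ x) j k where
  jk := h.jk
  cc := by have := h.cc.smul (-1); simpa using this
  cf := h.cf
  f0 := h.f0
  f12 := h.f12
  fz x hx hh := by rw [h.fz x hx hh, neg_zero]
  w χ hχ := by
    have h1 := Dir_smul (-1) h.cc hχ
    have h2 := IP_smul (-1) (fun x => f x * φ x) χ
    rw [h.w χ hχ, ← h2] at h1
    convert h1 using 2
    · ext x; ring
    · ext x; ring
  oj x hx := by rw [h.oj x hx]
  ok x hx := by rw [h.ok x hx]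
  ej := h.ej
  ek := h.ek

lemma zero (h : EP f φ j k) {x : E3} (hx : x ∈ S3) (h0 : x j * x k = 0) : φ x = 0 := by
  rcases mul_eq_zero.mp h0 with h0 | h0
  · have := h.oj x hx
    rw [Sol.refl_apply, h0] at this; simp at this; linarith
  · have := h.ok x hx
    rw [Sol.refl_apply, h0] at this; simp at this; linarith

/-- odd symmetrization -/
lemma symm_IP {ξ r : E3 → ℝ} (hξ : ContinuousOn ξ S3) (hr : ContinuousOn r S3)
    (oj : ∀ x ∈ S3, ξ (Sol.refl j x) = - ξ x) (ok : ∀ x ∈ S3, ξ (Sol.refl k x) = - ξ x) :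
    4 * IP ξ r = IP ξ (fun x => r x - r (Sol.refl j x) - r (Sol.refl k x) + r (Sol.refl j (Sol.refl k x))) := by
  have hc : ∀ R : E3 ≃ₗᵢ[ℝ] E3, ContinuousOn (fun x => r (R x)) S3 := fun R =>
    hr.comp R.continuous.continuousOn fun x hx => R_mem R hx
  have hjk : ContinuousOn (fun x => r (Sol.refl j (Sol.refl k x))) S3 :=
    (hc (Sol.refl j)).comp (Sol.refl k).continuous.continuousOn fun x hx => R_mem _ hx
  have hi : ∀ (i : Fin 3) (r : E3 → ℝ), (∀ x ∈ S3, ξ (Sol.refl i x) = - ξ x) → IP ξ (fun x => r (Sol.refl i x)) = - IP ξ r := by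
    intro i r ho
    unfold IP
    rw [← integral_comp_R (Sol.refl i) (fun x => ξ x * r x), ← integral_neg]
    refine int_congr fun x hx => ?_
    rw [ho x hx]; ring
  rw [IP_add_r (f := fun x => r x - r (Sol.refl j x) - r (Sol.refl k x)) ((hr.sub (hc _)).sub (hc _)) hjk hξ,
    IP_sub_r (f := fun x => r x - r (Sol.refl j x)) (hr.sub (hc _)) (hc _) hξ, IP_sub_r hr (hc _) hξ,
    hi j r oj, hi k r ok, hi k (fun x => r (Sol.refl j x)) ok, hi j r oj]
  ring

lemma orth {ξ : E3 → ℝ} (hjk : j ≠ k) (hξ : ContinuousOn ξ S3)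
    (oj : ∀ x ∈ S3, ξ (Sol.refl j x) = - ξ x) (ok : ∀ x ∈ S3, ξ (Sol.refl k x) = - ξ x)
    (h0 : IP ξ (fun x => x j * x k) = 0) : ∀ r ∈ PP 2, IP ξ r = 0 := by
  intro r hr
  refine (IP_span_zero ?_ hξ ?_ hr).2
  · rintro _ ⟨a, n, _, rfl⟩; exact CC_pow a n
  · rintro _ ⟨a, n, hn, rfl⟩
    have h1 := symm_IP hξ (CC_pow a n).contG oj ok
    have h2 : ∀ (m : ℝ), (∀ x : E3, (inner ℝ a x : ℝ)^n - (inner ℝ a (Sol.refl j x) : ℝ)^n - (inner ℝ a (Sol.refl k x) : ℝ)^n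
        + (inner ℝ a (Sol.refl j (Sol.refl k x)) : ℝ)^n = m * (x j * x k)) → IP ξ (fun x => (inner ℝ a x : ℝ)^n) = 0 := by
      intro m hm
      simp only [hm] at h1
      rw [IP_smul_r, h0] at h1
      linarith
    have e1 : ∀ (i : Fin 3) x, inner ℝ a (Sol.refl i x) = inner ℝ a x - 2 * x i * a i := by
      intro i x
      rw [Sol.refl_apply, inner_sub_right, inner_smul_right, inner_ee']
    have e2 : ∀ x, Sol.refl k x j = x j := fun x => by
      rw [Sol.refl_coord, if_neg hjk.symm]
    interval_cases n
    · exact h2 0 fun x => by simp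
    · refine h2 0 fun x => ?_
      simp only [e1, e2]; ring
    · refine h2 (8 * a j * a k) fun x => ?_
      simp only [e1, e2]; ring

end EP


def hn (n : ℕ) (t : ℝ) : ℝ := t - arctan ((n + 1) * t) / (n + 1)
def hn' (n : ℕ) (t : ℝ) : ℝ := 1 - 1 / (1 + ((n + 1) * t) ^ 2)

lemma hn_deriv (n : ℕ) (t : ℝ) : HasDerivAt (hn n) (hn' n t) t := by
  have h0 : ((n:ℝ) + 1) ≠ 0 := by positivity
  have h1 : HasDerivAt (fun t : ℝ => ((n:ℝ)+1) * t) ((n:ℝ)+1) t := by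
    simpa using (hasDerivAt_id t).const_mul ((n:ℝ)+1)
  have h2 := (hasDerivAt_id t).sub (h1.arctan.div_const ((n:ℝ)+1))
  refine h2.congr_deriv ?_
  unfold hn'
  field_simp

lemma hn_zero (n : ℕ) : hn n 0 = 0 := by simp [hn]
lemma hn'_zero (n : ℕ) : hn' n 0 = 0 := by simp [hn']
lemma hn_neg (n : ℕ) (t : ℝ) : hn n (-t) = - hn n t := by
  unfold hn; rw [mul_neg, arctan_neg]; ring
lemma hn'_nonneg (n : ℕ) (t : ℝ) : 0 ≤ hn' n t := by
  unfold hn'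
  rw [sub_nonneg, div_le_one (by positivity)]
  nlinarith [sq_nonneg (((n:ℝ)+1)*t)]
lemma hn'_le (n : ℕ) (t : ℝ) : hn' n t ≤ 1 := by
  unfold hn'
  have : 0 ≤ 1 / (1 + (((n:ℝ) + 1) * t) ^ 2) := by positivity
  linarith
lemma hn_cont (n : ℕ) : Continuous (hn n) := continuous_iff_continuousAt.mpr fun t => (hn_deriv n t).continuousAt
lemma hn'_cont (n : ℕ) : Continuous (hn' n) := by
  unfold hn'
  refine continuous_const.sub (continuous_const.div (by fun_prop) fun t => by positivity)
lemma hn_dist (n : ℕ) (t : ℝ) : |hn n t - t| ≤ 2 / (n + 1) := by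
  unfold hn
  have h0 : 0 < ((n:ℝ) + 1) := by positivity
  rw [show t - arctan ((n + 1) * t) / (n + 1) - t = - (arctan ((n + 1) * t) / (n + 1)) by ring, abs_neg, abs_div, abs_of_pos h0]
  gcongr
  rw [abs_le]
  have := arctan_lt_pi_div_two ((n+1)*t)
  have := neg_pi_div_two_lt_arctan ((n+1)*t)
  have := pi_le_four
  constructor <;> linarith
lemma hn_bd (n : ℕ) (t : ℝ) : |hn n t| ≤ |t| + 2 := by
  have h1 := hn_dist n t
  have h2 : 2 / ((n:ℝ) + 1) ≤ 2 := by
    rw [div_le_iff₀ (by positivity)]; nlinarith [Nat.cast_nonneg (α := ℝ) n]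
  have h3 := abs_sub_abs_le_abs_sub (hn n t) t
  linarith
lemma hn_tendsto (t : ℝ) : Filter.Tendsto (fun n => hn n t) Filter.atTop (nhds t) := by
  rw [tendsto_iff_dist_tendsto_zero]
  refine squeeze_zero (fun _ => dist_nonneg) (fun n => ?_) (g := fun n : ℕ => 2 * (1 / ((n:ℝ) + 1))) ?_
  · rw [Real.dist_eq]
    refine (hn_dist n t).trans (le_of_eq ?_); ring
  · have := (tendsto_one_div_add_atTop_nhds_zero_nat (𝕜 := ℝ)).const_mul 2
    simpa using this

/-- locally constant off the zero set -/
def Loc (φ c : E3 → ℝ) : Prop := (∀ x ∈ S3, φ x ≠ 0 → ∀ᶠ y in nhds x, c y = c x) ∧ ∃ C, 0 ≤ C ∧ ∀ x, |c x| ≤ C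

namespace Loc
variable {φ c : E3 → ℝ}

lemma cont {V : Type*} [NormedAddCommGroup V] [NormedSpace ℝ V] {w : E3 → V} (h : Loc φ c) (hw : ContinuousOn w S3)
    (h0 : ∀ x ∈ S3, φ x = 0 → w x = 0) : ContinuousOn (fun x => c x • w x) S3 := by
  intro x hx
  by_cases hz : φ x = 0
  · obtain ⟨C, hC0, hC⟩ := h.2
    have h1 := hw x hx
    have e := h0 x hx hz
    unfold ContinuousWithinAt at *
    rw [e] at h1
    simp only [e, smul_zero]
    refine squeeze_zero_norm (a := fun y => C * ‖w y‖) (fun y => ?_) ?_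
    · rw [norm_smul]; gcongr; exact hC y
    · simpa using h1.norm.const_mul C
  · have h1 := (hw x hx).const_smul (c x)
    refine h1.congr_of_eventuallyEq ?_ rfl
    filter_upwards [mem_nhdsWithin_of_mem_nhds (h.1 x hx hz)] with y hy
    rw [hy]; rfl

lemma C1 {w : E3 → ℝ} {g : E3 → E3} (h : Loc φ c) (hw : C1 w g)
    (h0 : ∀ x ∈ S3, φ x = 0 → w x = 0) (h0' : ∀ x ∈ S3, φ x = 0 → g x = 0) :
    C1 (fun x => c x * w x) (fun x => c x • g x) := by
  refine ⟨h.cont hw.cont h0', fun x hx => ?_⟩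
  by_cases hz : φ x = 0
  · obtain ⟨C, hC0, hC⟩ := h.2
    have h1 := hw.der x hx
    rw [h0' x hx hz] at h1 ⊢
    rw [smul_zero]
    rw [map_zero, hasFDerivAt_iff_isLittleO] at *
    simp only [zero_apply, sub_zero, h0 x hx hz, mul_zero] at *
    refine Asymptotics.IsBigO.trans_isLittleO ?_ h1
    refine Asymptotics.IsBigO.of_bound C (Filter.Eventually.of_forall fun y => ?_)
    rw [norm_mul]; gcongr; exact hC y
  · have h1 := (hw.der x hx).const_mul (c x)
    rw [← map_smul] at h1
    refine h1.congr_of_eventuallyEq ?_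
    filter_upwards [h.1 x hx hz] with y hy
    rw [hy]

lemma sq (h : Loc φ c) : Loc φ (fun x => c x ^ 2) := by
  refine ⟨fun x hx hz => (h.1 x hx hz).mono fun y hy => by simp only [hy], ?_⟩
  obtain ⟨C, hC0, hC⟩ := h.2
  exact ⟨C ^ 2, by positivity, fun x => by rw [abs_pow]; gcongr; exact hC x⟩

lemma comb {d : E3 → ℝ} (h : Loc φ c) (h' : Loc φ d) (a b : ℝ) : Loc φ (fun x => a * c x + b * d x) := by
  refine ⟨fun x hx hz => ?_, ?_⟩
  · filter_upwards [h.1 x hx hz, h'.1 x hx hz] with y h1 h2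
    rw [h1, h2]
  obtain ⟨C, hC0, hC⟩ := h.2
  obtain ⟨D, hD0, hD⟩ := h'.2
  refine ⟨|a| * C + |b| * D, by positivity, fun x => (abs_add_le _ _).trans ?_⟩
  rw [abs_mul, abs_mul]
  gcongr
  · exact hC x
  · exact hD x

end Loc

namespace EP
variable {f φ : E3 → ℝ} {j k : Fin 3}

lemma C1_hn (h : EP f φ j k) (n : ℕ) : C1 (fun x => hn n (φ x)) (fun x => hn' n (φ x) • gradient φ x) :=
  C1.comp h.cc (fun x _ => hn_deriv n _) ((hn'_cont n).comp_continuousOn h.cc.contG)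

lemma C1_chn (h : EP f φ j k) (n : ℕ) {c : E3 → ℝ} (hc : Loc φ c) :
    C1 (fun x => c x * hn n (φ x)) (fun x => c x • hn' n (φ x) • gradient φ x) :=
  hc.C1 (h.C1_hn n) (fun x _ hz => by simp only [hz, hn_zero]) (fun x _ hz => by simp only [hz, hn'_zero, zero_smul])

lemma energy (h : EP f φ j k) (n : ℕ) {c : E3 → ℝ} (hc : Loc φ c)
    (cj : ∀ x ∈ S3, φ x ≠ 0 → c (Sol.refl j x) = c x) (ck : ∀ x ∈ S3, φ x ≠ 0 → c (Sol.refl k x) = c x)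
    (h0 : ∫ x, c x * hn n (φ x) * (x j * x k) ∂sig = 0) :
    ∫ x, c x ^ 2 * (12 * hn n (φ x) ^ 2 - f x * φ x * hn n (φ x)) ∂sig ≤ 0 := by
  have h1 := h.C1_chn n hc
  have h2 := h.C1_chn n hc.sq
  have ho : ∀ i, (∀ x ∈ S3, φ x ≠ 0 → c (Sol.refl i x) = c x) → (∀ x ∈ S3, φ (Sol.refl i x) = - φ x) →
      ∀ x ∈ S3, c (Sol.refl i x) * hn n (φ (Sol.refl i x)) = - (c x * hn n (φ x)) := by
    intro i hci hpi x hx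
    rw [hpi x hx, hn_neg]
    by_cases hz : φ x = 0
    · rw [hz, hn_zero]; simp
    · rw [hci x hx hz]; ring
  have hg := gap h1.CC (orth h.jk h1.contG (ho j cj h.oj) (ho k ck h.ok) h0)
  have hle : Dir (fun x => c x * hn n (φ x)) (fun x => c x * hn n (φ x)) ≤ Dir φ (fun x => c x ^ 2 * hn n (φ x)) := by
    rw [h1.Dir h1, C1.Dir h.cc h2]
    refine int_mono (cont_Gm h1.cont h1.cont) (cont_Gm h.cc.cont h2.cont) fun x hx => ?_
    have e1 : Gm x (c x • hn' n (φ x) • gradient φ x) (c x • hn' n (φ x) • gradient φ x) =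
      (c x ^ 2 * Gm x (gradient φ x) (gradient φ x)) * (hn' n (φ x) * hn' n (φ x)) := by
      unfold Gm; simp only [inner_smul_left, inner_smul_right, conj_trivial]; ring
    have e2 : Gm x (gradient φ x) (c x ^ 2 • hn' n (φ x) • gradient φ x) =
      (c x ^ 2 * Gm x (gradient φ x) (gradient φ x)) * hn' n (φ x) := by
      unfold Gm; simp only [inner_smul_right]; ring
    rw [e1, e2]
    have := Gm_self_nonneg hx (gradient φ x)
    refine mul_le_mul_of_nonneg_left ?_ (by positivity)
    nlinarith [hn'_nonneg n (φ x), hn'_le n (φ x)]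
  rw [h.w _ h2.CC] at hle
  have e : ∫ x, c x ^ 2 * (12 * hn n (φ x) ^ 2 - f x * φ x * hn n (φ x)) ∂sig =
      12 * IP (fun x => c x * hn n (φ x)) (fun x => c x * hn n (φ x)) - IP (fun x => f x * φ x) (fun x => c x ^ 2 * hn n (φ x)) := by
    unfold IP
    rw [← integral_const_mul, ← integral_sub]
    · congr 1; ext x; ring
    · exact (int_mul h1.contG h1.contG).const_mul _
    · exact int_mul (h.cf.mul h.cc.contG) h2.contG
  rw [e]; linarith

lemma lim1 (h : EP f φ j k) {c : E3 → ℝ} (hc : Loc φ c) :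
    Filter.Tendsto (fun n => ∫ x, c x * hn n (φ x) * (x j * x k) ∂sig) Filter.atTop (nhds (∫ x, c x * φ x * (x j * x k) ∂sig)) := by
  obtain ⟨C, hC0, hC⟩ := hc.2
  obtain ⟨B, hB0, hB⟩ := exists_bound h.cc.contG
  have hm : Continuous (fun x : E3 => x j * x k) := by fun_prop
  obtain ⟨M, hM0, hM⟩ := exists_bound hm.continuousOn
  refine tendsto_integral_of_dominated_convergence (fun _ => C * (B + 2) * M) (fun n => ?_) (integrable_const _) (fun n => ?_) ?_
  · exact (int_mul (h.C1_chn n hc).contG hm.continuousOn).aestronglyMeasurable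
  · refine sig_ae.mono fun x hx => ?_
    rw [norm_mul, norm_mul]
    gcongr
    · exact hC x
    · exact (hn_bd n _).trans (by have := hB x hx; rw [Real.norm_eq_abs] at this; linarith)
    · exact hM x hx
  · exact Filter.Eventually.of_forall fun x => (((hn_tendsto (φ x)).const_mul _).mul_const _)

lemma cont2 (h : EP f φ j k) (n : ℕ) {c : E3 → ℝ} (hc : Loc φ c) : 
    ContinuousOn (fun x => c x * (12 * hn n (φ x) ^ 2 - f x * φ x * hn n (φ x))) S3 := by
  have hh := (h.C1_hn n).contG
  refine hc.cont (w := fun x => 12 * hn n (φ x) ^ 2 - f x * φ x * hn n (φ x))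
    ((continuousOn_const.mul (hh.pow 2)).sub ((h.cf.mul h.cc.contG).mul hh)) fun x _ hz => ?_
  simp [hz, hn_zero]

lemma lim2 (h : EP f φ j k) {c : E3 → ℝ} (hc : Loc φ c) :
    Filter.Tendsto (fun n => ∫ x, c x * (12 * hn n (φ x) ^ 2 - f x * φ x * hn n (φ x)) ∂sig) Filter.atTop
      (nhds (∫ x, c x * (12 * φ x ^ 2 - f x * φ x * φ x) ∂sig)) := by
  obtain ⟨C, hC0, hC⟩ := hc.2
  obtain ⟨B, hB0, hB⟩ := exists_bound h.cc.contG
  refine tendsto_integral_of_dominated_convergence (fun _ => C * (12 * (B + 2) ^ 2 + 12 * B * (B + 2))) (fun n => ?_) (integrable_const _) (fun n => ?_) ?_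
  · exact (int_cont (h.cont2 n hc)).aestronglyMeasurable
  · refine sig_ae.mono fun x hx => ?_
    have hb := hB x hx
    rw [Real.norm_eq_abs] at hb
    have hh : |hn n (φ x)| ≤ B + 2 := (hn_bd n _).trans (by linarith)
    rw [norm_mul]
    gcongr
    · exact hC x
    · rw [Real.norm_eq_abs]
      refine (abs_sub _ _).trans ?_
      rw [abs_mul, abs_mul, abs_mul, abs_pow, abs_of_pos (h.f0 x hx)]
      have := h.f12 x hx
      rw [abs_of_pos (by norm_num : (0:ℝ) < 12)]
      gcongr
  · exact Filter.Eventually.of_forall fun x => (((((hn_tendsto (φ x)).pow 2).const_mul _).sub ((hn_tendsto (φ x)).const_mul _)).const_mul _)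

lemma m_refl (hjk : j ≠ k) (i : Fin 3) (hi : i = j ∨ i = k) (x : E3) : Sol.refl i x j * Sol.refl i x k = - (x j * x k) := by
  rw [Sol.refl_coord, Sol.refl_coord]
  rcases hi with rfl | rfl
  · simp [hjk]
  · simp [hjk.symm]

open Classical in
lemma loc_ind (h : EP f φ j k) (s : ℝ) : Loc φ (fun x => if 0 < s * (φ x * (x j * x k)) then 1 else 0) := by
  refine ⟨fun x hx hz => ?_, 1, zero_le_one, fun x => by dsimp only; split_ifs <;> simp⟩
  have hm : x j * x k ≠ 0 := fun h0 => hz (h.zero hx h0)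
  have hc : ContinuousAt (fun x : E3 => s * (φ x * (x j * x k))) x :=
    continuousAt_const.mul ((h.cc.der x hx).continuousAt.mul (by fun_prop))
  rcases eq_or_ne s 0 with rfl | hs
  · simp
  have hne : s * (φ x * (x j * x k)) ≠ 0 := mul_ne_zero hs (mul_ne_zero hz hm)
  rcases hne.lt_or_gt with h1 | h1
  · filter_upwards [hc.eventually_lt_const h1] with y hy
    rw [if_neg hy.not_gt, if_neg h1.not_gt]
  · filter_upwards [hc.eventually_const_lt h1] with y hy
    rw [if_pos hy, if_pos h1]

open Classical in
lemma sign (h : EP f φ j k) : (∀ x ∈ S3, 0 ≤ φ x * (x j * x k)) ∨ (∀ x ∈ S3, φ x * (x j * x k) ≤ 0) := by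
  set c : E3 → ℝ := fun x => if 0 < 1 * (φ x * (x j * x k)) then 1 else 0 with hcd
  set d : E3 → ℝ := fun x => if 0 < (-1) * (φ x * (x j * x k)) then 1 else 0 with hdd
  have hc : Loc φ c := h.loc_ind 1
  have hd : Loc φ d := h.loc_ind (-1)
  have hsym : ∀ i, (i = j ∨ i = k) → ∀ x ∈ S3, c (Sol.refl i x) = c x ∧ d (Sol.refl i x) = d x := by
    intro i hi x hx
    have h1 : φ (Sol.refl i x) = - φ x := by
      rcases hi with rfl | rfl
      · exact h.oj x hx
      · exact h.ok x hx
    simp only [hcd, hdd]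
    rw [m_refl h.jk i hi, h1]
    simp
  have hcd0 : ∀ x, c x * d x = 0 := fun x => by
    simp only [hcd, hdd]; split_ifs <;> first | (exfalso; linarith) | simp
  have hcc : ∀ x, c x ^ 2 = c x := fun x => by simp only [hcd]; split_ifs <;> simp
  have hdd2 : ∀ x, d x ^ 2 = d x := fun x => by simp only [hdd]; split_ifs <;> simp
  let α : ℕ → ℝ := fun n => ∫ x, d x * hn n (φ x) * (x j * x k) ∂sig
  let β : ℕ → ℝ := fun n => ∫ x, c x * hn n (φ x) * (x j * x k) ∂sig
  let P : ℕ → ℝ := fun n => ∫ x, c x * (12 * hn n (φ x) ^ 2 - f x * φ x * hn n (φ x)) ∂sig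
  let Q : ℕ → ℝ := fun n => ∫ x, d x * (12 * hn n (φ x) ^ 2 - f x * φ x * hn n (φ x)) ∂sig
  have hm : Continuous (fun x : E3 => x j * x k) := by fun_prop
  have hn0 : ∀ n, α n ^ 2 * P n + β n ^ 2 * Q n ≤ 0 := by
    intro n
    have h1 := h.energy n (hc.comb hd (α n) (-β n))
      (fun x hx _ => by rw [(hsym j (Or.inl rfl) x hx).1, (hsym j (Or.inl rfl) x hx).2])
      (fun x hx _ => by rw [(hsym k (Or.inr rfl) x hx).1, (hsym k (Or.inr rfl) x hx).2]) (by
        have : ∫ x, (α n * c x + -β n * d x) * hn n (φ x) * (x j * x k) ∂sig = α n * β n + (-β n) * α n := by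
          simp only [α, β]
          rw [← integral_const_mul, ← integral_const_mul, ← integral_add]
          · congr 1; ext x; ring
          · exact (int_mul (h.C1_chn n hc).contG hm.continuousOn).const_mul _
          · exact (int_mul (h.C1_chn n hd).contG hm.continuousOn).const_mul _
        rw [this]; ring)
    refine le_trans (le_of_eq ?_) h1
    simp only [P, Q]
    rw [← integral_const_mul, ← integral_const_mul, ← integral_add]
    · congr 1; ext x
      have e : (α n * c x + -β n * d x) ^ 2 = α n ^ 2 * c x + β n ^ 2 * d x := by
        linear_combination α n ^ 2 * hcc x + β n ^ 2 * hdd2 x - 2 * α n * β n * hcd0 x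
      rw [e]; ring
    · exact (int_cont (h.cont2 n hc)).const_mul _
    · exact (int_cont (h.cont2 n hd)).const_mul _
  have hlim := le_of_tendsto' ((((h.lim1 hd).pow 2).mul (h.lim2 hc)).add (((h.lim1 hc).pow 2).mul (h.lim2 hd))) hn0
  have hpos : ∀ x ∈ S3, 0 ≤ 12 * φ x ^ 2 - f x * φ x * φ x := fun x hx => by
    nlinarith [mul_nonneg (sub_nonneg.mpr (h.f12 x hx)) (sq_nonneg (φ x))]
  have hc0 : ∀ x, 0 ≤ c x := fun x => by simp only [hcd]; split_ifs <;> simp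
  have hd0 : ∀ x, 0 ≤ d x := fun x => by simp only [hdd]; split_ifs <;> simp
  by_contra hcon
  push Not at hcon
  obtain ⟨⟨x1, hx1, hn1⟩, ⟨x2, hx2, hn2⟩⟩ := hcon
  have hP : 0 ≤ ∫ x, c x * (12 * φ x ^ 2 - f x * φ x * φ x) ∂sig := int_nonneg fun x hx => mul_nonneg (hc0 x) (hpos x hx)
  have hQ : 0 ≤ ∫ x, d x * (12 * φ x ^ 2 - f x * φ x * φ x) ∂sig := int_nonneg fun x hx => mul_nonneg (hd0 x) (hpos x hx)
  have hα : ∫ x, d x * φ x * (x j * x k) ∂sig ≠ 0 := by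
    intro h0
    have hcont : ContinuousOn (fun x => - (d x * φ x * (x j * x k))) S3 :=
      ((hd.cont h.cc.contG fun x _ hz => hz).mul hm.continuousOn).neg
    have := int_pos_zero hcont (fun x hx => by
      simp only [hdd]; split_ifs with hh
      · linarith
      · simp) (by rw [integral_neg, h0]; simp) x1 hx1
    simp only [hdd] at this
    rw [if_pos (by linarith)] at this
    linarith
  have hP0 : ∫ x, c x * (12 * φ x ^ 2 - f x * φ x * φ x) ∂sig ≤ 0 := by
    by_contra hlt
    push Not at hlt
    have h1 : 0 < (∫ x, d x * φ x * (x j * x k) ∂sig) ^ 2 := by positivity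
    have h2 := mul_pos h1 hlt
    have h3 := mul_nonneg (sq_nonneg (∫ x, c x * φ x * (x j * x k) ∂sig)) hQ
    linarith
  have hcont2 : ContinuousOn (fun x => c x * (12 * φ x ^ 2 - f x * φ x * φ x)) S3 :=
    hc.cont (w := fun x => 12 * φ x ^ 2 - f x * φ x * φ x)
      ((continuousOn_const.mul (h.cc.contG.pow 2)).sub ((h.cf.mul h.cc.contG).mul h.cc.contG)) fun x _ hz => by simp [hz]
  have h9 := int_pos_zero hcont2 (fun x hx => mul_nonneg (hc0 x) (hpos x hx)) hP0 x2 hx2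
  simp only [hcd] at h9
  rw [if_pos (by linarith), one_mul] at h9
  have h10 : φ x2 ≠ 0 := fun h0 => by rw [h0, zero_mul] at hn2; exact lt_irrefl _ hn2
  have h11 : (12 - f x2) * φ x2 ^ 2 = 0 := by linarith
  rcases mul_eq_zero.mp h11 with h12 | h12
  · exact h10 (h.fz x2 hx2 (by linarith))
  · exact h10 (pow_eq_zero_iff (by norm_num) |>.mp h12)

end EP


lemma log_aux {A p q : ℝ} (h1 : 0 < A - p - q) (h2 : 0 < A + p - q) (h3 : 0 < A - p + q) (h4 : 0 < A + p + q)
    (g1 : A - p - q ≤ 3) (g2 : A + p - q ≤ 3) (g3 : A - p + q ≤ 3) (g4 : A + p + q ≤ 3) :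
    (4/9) * (p * q) ^ 2 ≤ (p * q) * (- log (A - p - q) + log (A + p - q) + log (A - p + q) - log (A + p + q)) := by
  have hN : 0 < (A + p - q) * (A - p + q) := mul_pos h2 h3
  have hM : 0 < (A - p - q) * (A + p + q) := mul_pos h1 h4
  have hN9 : (A + p - q) * (A - p + q) ≤ 9 := by nlinarith
  have hM9 : (A - p - q) * (A + p + q) ≤ 9 := by nlinarith
  have e : - log (A - p - q) + log (A + p - q) + log (A - p + q) - log (A + p + q) =
      log ((A + p - q) * (A - p + q)) - log ((A - p - q) * (A + p + q)) := by
    rw [log_mul h2.ne' h3.ne', log_mul h1.ne' h4.ne']; ring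
  rw [e]
  have hd : (A + p - q) * (A - p + q) - (A - p - q) * (A + p + q) = 4 * (p * q) := by ring
  generalize (A + p - q) * (A - p + q) = N at *
  generalize (A - p - q) * (A + p + q) = M at *
  generalize p * q = r at *
  rcases le_total 0 r with hr | hr
  · have h5 := Real.add_one_le_exp (log M - log N)
    have h5 : 1 - M / N ≤ log N - log M := by
      rw [exp_sub, exp_log hN, exp_log hM] at h5; linarith
    have h6 : 4/9 * r ≤ 1 - M / N := by
      rw [show 1 - M / N = (4 * r) / N by rw [← hd]; field_simp, le_div_iff₀ hN]
      nlinarith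
    nlinarith
  · have h5 := Real.add_one_le_exp (log N - log M)
    have h5 : 1 - N / M ≤ log M - log N := by
      rw [exp_sub, exp_log hN, exp_log hM] at h5; linarith
    have h6 : 4/9 * (-r) ≤ 1 - N / M := by
      rw [show 1 - N / M = (-(4 * r)) / M by rw [← hd]; field_simp; ring, le_div_iff₀ hM]
      nlinarith
    nlinarith

lemma fin_aux {τ m κ φ : ℝ} (hs : 0 ≤ φ * m) (hz : m = 0 → φ = 0)
    (h : (4/9) * (τ * m) ^ 2 ≤ τ * m * κ) : (4/9) * τ ^ 2 * (φ * m) ≤ τ * (φ * κ) := by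
  rcases lt_trichotomy m 0 with hm0 | hm0 | hm0
  · have b1 : τ * κ ≤ 4/9 * τ ^ 2 * m := by
      by_contra hc; push Not at hc; nlinarith [mul_lt_mul_of_neg_left hc hm0]
    have b2 : φ ≤ 0 := by
      by_contra hc; push Not at hc; nlinarith [mul_neg_of_pos_of_neg hc hm0]
    nlinarith [mul_le_mul_of_nonpos_left b1 b2]
  · rw [hz hm0]; simp
  · have b1 : 4/9 * τ ^ 2 * m ≤ τ * κ := by
      by_contra hc; push Not at hc; nlinarith [mul_lt_mul_of_pos_left hc hm0]
    have b2 : 0 ≤ φ := by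
      by_contra hc; push Not at hc; nlinarith [mul_neg_of_neg_of_pos hc hm0]
    nlinarith [mul_le_mul_of_nonneg_left b1 b2]

lemma inner_le_one {x y : E3} (hx : x ∈ S3) (hy : y ∈ S3) : |(inner ℝ y x : ℝ)| ≤ 1 := by
  have := abs_real_inner_le_norm y x
  rwa [mem_S3.mp hx, mem_S3.mp hy, mul_one] at this

namespace EP
variable {f φ : E3 → ℝ} {j k : Fin 3}

lemma int_zero (h : EP f φ j k) : ∫ x, φ x ∂sig = 0 := by
  have h1 := integral_comp_R (Sol.refl j) φ
  rw [int_congr h.oj, integral_neg] at h1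
  linarith

set_option maxHeartbeats 1000000 in
lemma vanish (h : EP f φ j k) (hs : ∀ x ∈ S3, 0 ≤ φ x * (x j * x k)) {y : E3} (hy : y ∈ S3)
    (hne : y j * y k ≠ 0) (hv : ∀ᶠ x in nhdsWithin y S3, φ x = 0) : ∀ x ∈ S3, φ x = 0 := by
  obtain ⟨δ, hδ, hball⟩ := Metric.mem_nhdsWithin_iff.mp hv
  obtain ⟨B, hB0, hB⟩ := exists_bound h.cc.contG
  have hyy : inner ℝ y y = (1:ℝ) := S3_inner hy
  set τ := y j * y k with hτ
  have hfφ : ContinuousOn (fun x => f x * φ x) S3 := h.cf.mul h.cc.contG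
  have hm : Continuous (fun x : E3 => x j * x k) := by fun_prop
  -- main estimate
  have main : ∀ ε : ℝ, 0 < ε → ε ≤ 1 → τ ^ 2 * ∫ x, f x * (φ x * (x j * x k)) ∂sig ≤
      (9 * |τ| * (3 * (∫ _x, B / (δ^2/2)^2 ∂sig))) * ε := by
    intro ε hε hε1
    have hw : ∀ x ∈ S3, 0 < 1 + ε - inner ℝ y x := fun x hx => by
      have := (abs_le.mp (inner_le_one hx hy)).2; linarith
    have hw3 : ∀ x ∈ S3, 1 + ε - inner ℝ y x ≤ 3 := fun x hx => by
      have := (abs_le.mp (inner_le_one hx hy)).1; linarith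
    let K : ℝ → ℝ := fun t => - log (1 + ε - t)
    let K' : ℝ → ℝ := fun t => (1 + ε - t)⁻¹
    let K'' : ℝ → ℝ := fun t => ((1 + ε - t)^2)⁻¹
    have hl : ∀ t : ℝ, HasDerivAt (fun t => 1 + ε - t) (-1) t := fun t => by
      simpa using (hasDerivAt_id t).const_sub (1 + ε)
    have d1 : ∀ x ∈ S3, HasDerivAt K (K' (inner ℝ y x)) (inner ℝ y x) := fun x hx => by
      refine ((hl _).log (hw x hx).ne').neg.congr_deriv ?_
      simp only [K']; field_simp
    have d2 : ∀ x ∈ S3, HasDerivAt K' (K'' (inner ℝ y x)) (inner ℝ y x) := fun x hx => by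
      refine ((hl _).fun_inv (hw x hx).ne').congr_deriv ?_
      simp only [K'']; field_simp
    have d3 : ContinuousOn (fun x : E3 => K'' (inner ℝ y x)) S3 := by
      refine ContinuousOn.inv₀ (by fun_prop) fun x hx => ?_
      have := hw x hx; positivity
    have hC2 := zonal_C2 y d1 d2 d3
    have hgz := green_zonal y (k := K) (k' := K') (k'' := K'') d1 d2 d3 h.cc
    have hK := hC2.c1
    have e1 : IP (fun x => f x * φ x) (fun x => K (inner ℝ y x)) = (2 * ε + ε ^ 2) * ∫ x, K'' (inner ℝ y x) * φ x ∂sig := by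
      rw [← h.w _ hK.CC, Dir_comm, C1.Dir hK h.cc, hgz, ← integral_const_mul]
      have : ∫ x, (2 * ε + ε ^ 2) * (K'' (inner ℝ y x) * φ x) ∂sig - ∫ x, φ x ∂sig = ∫ x, ((2 * ε + ε ^ 2) * (K'' (inner ℝ y x) * φ x) - φ x) ∂sig := 
        (integral_sub ((int_mul d3 h.cc.contG).const_mul _) (int_cont h.cc.contG)).symm
      rw [h.int_zero, sub_zero] at this
      rw [this, ← integral_neg]
      refine int_congr fun x hx => ?_
      rw [hyy]
      have := hw x hx
      simp only [K', K'']
      field_simp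
      ring
    have e2 : |∫ x, K'' (inner ℝ y x) * φ x ∂sig| ≤ ∫ _x, B / (δ^2/2)^2 ∂sig := by
      refine abs_integral_le_integral_abs.trans ?_
      refine int_mono (d3.mul h.cc.contG).abs continuousOn_const fun x hx => ?_
      by_cases hxb : x ∈ Metric.ball y δ
      · have : φ x = 0 := hball ⟨hxb, hx⟩
        rw [this, mul_zero, abs_zero]; positivity
      · rw [Metric.mem_ball, not_lt, dist_eq_norm] at hxb
        have h1 : ‖x - y‖ ^ 2 = 2 - 2 * inner ℝ y x := by
          rw [norm_sub_sq_real, mem_S3.mp hx, mem_S3.mp hy, real_inner_comm]; ring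
        have h2 : δ ^ 2 ≤ ‖x - y‖ ^ 2 := by gcongr
        have h3 : δ ^ 2 / 2 ≤ 1 + ε - inner ℝ y x := by linarith
        have h4 := hB x hx
        rw [Real.norm_eq_abs] at h4
        rw [abs_mul]
        simp only [K'']
        rw [abs_of_pos (by have := hw x hx; positivity), inv_mul_eq_div]
        gcongr
    have e3 := symm_IP hfφ hK.contG (j := j) (k := k) (fun x hx => by rw [h.ej x hx, h.oj x hx]; ring)
      (fun x hx => by rw [h.ek x hx, h.ok x hx]; ring)
    have e4 : (4/9) * (τ ^ 2 * ∫ x, f x * (φ x * (x j * x k)) ∂sig) ≤ τ * (4 * IP (fun x => f x * φ x) (fun x => K (inner ℝ y x))) := by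
      rw [e3, ← mul_assoc, ← integral_const_mul]
      unfold IP
      rw [← integral_const_mul]
      have hcR : ∀ R : E3 ≃ₗᵢ[ℝ] E3, ContinuousOn (fun x => K (inner ℝ y (R x))) S3 := fun R =>
        hK.contG.comp R.continuous.continuousOn fun x hx => R_mem R hx
      have hcRR : ContinuousOn (fun x => K (inner ℝ y (Sol.refl j (Sol.refl k x)))) S3 :=
        (hcR (Sol.refl j)).comp (Sol.refl k).continuous.continuousOn fun x hx => R_mem _ hx
      refine int_mono (continuousOn_const.mul (h.cf.mul (h.cc.contG.mul hm.continuousOn)))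
        (continuousOn_const.mul (hfφ.mul (((hK.contG.sub (hcR _)).sub (hcR _)).add hcRR))) fun x hx => ?_
      have q1 := hw x hx
      have q2 := hw _ (R_mem (Sol.refl j) hx)
      have q3 := hw _ (R_mem (Sol.refl k) hx)
      have q4 := hw _ (R_mem (Sol.refl j) (R_mem (Sol.refl k) hx))
      have r1 := hw3 x hx
      have r2 := hw3 _ (R_mem (Sol.refl j) hx)
      have r3 := hw3 _ (R_mem (Sol.refl k) hx)
      have r4 := hw3 _ (R_mem (Sol.refl j) (R_mem (Sol.refl k) hx))
      have a1 : ∀ (i : Fin 3) x, inner ℝ y (Sol.refl i x) = inner ℝ y x - 2 * x i * y i := by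
        intro i x
        rw [Sol.refl_apply, inner_sub_right, inner_smul_right, inner_ee']
      have a2 : Sol.refl k x j = x j := by rw [Sol.refl_coord, if_neg h.jk.symm]
      have hsx := hs x hx
      have hz := fun h0 => h.zero hx h0
      have c1 := a1 j x
      have c2 := a1 k x
      have c3 : inner ℝ y (Sol.refl j (Sol.refl k x)) = inner ℝ y x - 2 * x k * y k - 2 * x j * y j := by
        rw [a1 j (Sol.refl k x), a2, c2]
      simp only [K]
      rw [c1] at q2 r2 ⊢
      rw [c2] at q3 r3 ⊢
      rw [c3] at q4 r4 ⊢
      have hfx := h.f0 x hx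
      have := log_aux (A := 1 + ε - inner ℝ y x + x j * y j + x k * y k) (p := x j * y j) (q := x k * y k)
        (by linarith) (by linarith) (by linarith) (by linarith) (by linarith) (by linarith) (by linarith) (by linarith)
      rw [show 1 + ε - inner ℝ y x + x j * y j + x k * y k - x j * y j - x k * y k = 1 + ε - inner ℝ y x by ring,
        show 1 + ε - inner ℝ y x + x j * y j + x k * y k + x j * y j - x k * y k = 1 + ε - (inner ℝ y x - 2 * x j * y j) by ring,
        show 1 + ε - inner ℝ y x + x j * y j + x k * y k - x j * y j + x k * y k = 1 + ε - (inner ℝ y x - 2 * x k * y k) by ring,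
        show 1 + ε - inner ℝ y x + x j * y j + x k * y k + x j * y j + x k * y k = 1 + ε - (inner ℝ y x - 2 * x k * y k - 2 * x j * y j) by ring,
        show x j * y j * (x k * y k) = τ * (x j * x k) by rw [hτ]; ring] at this
      set κ := -log (1 + ε - inner ℝ y x) - -log (1 + ε - (inner ℝ y x - 2 * x j * y j)) - -log (1 + ε - (inner ℝ y x - 2 * x k * y k))
        + -log (1 + ε - (inner ℝ y x - 2 * x k * y k - 2 * x j * y j)) with hκ
      have this : (4/9) * (τ * (x j * x k)) ^ 2 ≤ τ * (x j * x k) * κ := by rw [hκ]; linarith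
      clear_value κ
      generalize x j * x k = m at *
      have fin : (4/9) * τ ^ 2 * (φ x * m) ≤ τ * (φ x * κ) := fin_aux hsx hz this
      have := mul_le_mul_of_nonneg_left fin hfx.le
      calc _ = f x * ((4/9) * τ ^ 2 * (φ x * m)) := by ring
        _ ≤ _ := this
        _ = _ := by ring
    rw [e1] at e4
    have e5 : τ * ∫ x, K'' (inner ℝ y x) * φ x ∂sig ≤ |τ| * ∫ _x, B / (δ^2/2)^2 ∂sig := by
      refine (le_abs_self _).trans ?_
      rw [abs_mul]; gcongr
    have e6 : 0 ≤ |τ| * ∫ _x : E3, B / (δ^2/2)^2 ∂sig := mul_nonneg (abs_nonneg _) (le_trans (abs_nonneg _) e2)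
    nlinarith [mul_le_mul_of_nonneg_left e5 (show 0 ≤ 2 * ε + ε^2 by positivity), mul_nonneg e6 (mul_nonneg hε.le (sub_nonneg.mpr hε1))]
  -- conclude
  have hI : ∫ x, f x * (φ x * (x j * x k)) ∂sig ≤ 0 := by
    have ht : 0 < τ ^ 2 := by positivity
    have : τ ^ 2 * ∫ x, f x * (φ x * (x j * x k)) ∂sig ≤ 0 := by
      set D := (9 * |τ| * (3 * (∫ _x : E3, B / (δ^2/2)^2 ∂sig)))
      refine le_of_forall_pos_le_add fun η hη => ?_
      rw [zero_add]
      have hp : 0 < |D| + 1 := by positivity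
      have h1 := main (min 1 (η / (|D| + 1))) (by positivity) (min_le_left _ _)
      refine h1.trans ?_
      have h2 : min 1 (η / (|D| + 1)) ≤ η / (|D| + 1) := min_le_right _ _
      have h3 : 0 < min 1 (η / (|D| + 1)) := by positivity
      rw [le_div_iff₀ hp] at h2
      nlinarith [le_abs_self D]
    by_contra hc
    push Not at hc
    nlinarith [mul_pos ht hc]
  have h0 := int_pos_zero (h.cf.mul (h.cc.contG.mul hm.continuousOn)) (fun x hx => mul_nonneg (h.f0 x hx).le (hs x hx)) hI
  intro x hx
  rcases mul_eq_zero.mp (h0 x hx) with h1 | h1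
  · exact absurd h1 (h.f0 x hx).ne'
  · rcases mul_eq_zero.mp h1 with h2 | h2
    · exact h2
    · exact h.zero hx h2

lemma vanish' (h : EP f φ j k) {y : E3} (hy : y ∈ S3)
    (hne : y j * y k ≠ 0) (hv : ∀ᶠ x in nhdsWithin y S3, φ x = 0) : ∀ x ∈ S3, φ x = 0 := by
  rcases h.sign with hs | hs
  · exact h.vanish hs hy hne hv
  · intro x hx
    have := h.neg.vanish (fun x hx => by have := hs x hx; linarith) hy hne (hv.mono fun x hx => by simp [hx]) x hx
    linarith

end EP


lemma polar2 (a b : ℝ) : ∃ t, a = √(a^2+b^2) * cos t ∧ b = √(a^2+b^2) * sin t := by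
  refine ⟨Complex.arg ⟨a, b⟩, ?_, ?_⟩
  · have := Complex.norm_mul_cos_arg ⟨a, b⟩
    rw [Complex.norm_eq_sqrt_sq_add_sq] at this; exact this.symm
  · have := Complex.norm_mul_sin_arg ⟨a, b⟩
    rw [Complex.norm_eq_sqrt_sq_add_sq] at this; exact this.symm

lemma EP.freq {f φ : E3 → ℝ} {j k : Fin 3} (h : EP f φ j k) (hn : ¬ ∀ x ∈ S3, φ x = 0) {y : E3} (hy : y ∈ S3)
    (hne : y j * y k ≠ 0) : ∃ᶠ x in nhdsWithin y S3, φ x ≠ 0 := by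
  intro hc
  exact hn (h.vanish' hy hne (hc.mono fun x hx => by simpa using hx))

namespace Sol
variable {lam : ℝ} {F : E3 → ℝ} {G : E3 → E3} {H : E3 → E3 →L[ℝ] E3}

lemma sym_of_zero (h : Sol lam F G H) {i j k : Fin 3} (hij : i ≠ j) (hik : i ≠ k) (hjk : j ≠ k)
    (hz : ∀ x ∈ S3, ph G (ee j) (ee k) x = 0) {x x' : E3} (hx : x ∈ S3) (hx' : x' ∈ S3) (he : x i = x' i) :
    F x = F x' := by
  have h3 : ∀ z : E3, z 0 ^ 2 + z 1 ^ 2 + z 2 ^ 2 = z i ^ 2 + z j ^ 2 + z k ^ 2 := by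
    intro z
    fin_cases i <;> fin_cases j <;> fin_cases k <;> simp at hij hik hjk ⊢ <;> ring
  have hl : ∀ l, l = i ∨ l = j ∨ l = k := by
    intro l
    fin_cases i <;> fin_cases j <;> fin_cases k <;> simp at hij hik hjk <;> fin_cases l <;> simp
  have e1 := S3_sq hx
  have e2 := S3_sq hx'
  rw [h3] at e1 e2
  have hr : x j ^ 2 + x k ^ 2 = x' j ^ 2 + x' k ^ 2 := by rw [he] at e1; linarith
  obtain ⟨a, ha1, ha2⟩ := polar2 (x j) (x k)
  obtain ⟨b, hb1, hb2⟩ := polar2 (x' j) (x' k)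
  rw [← hr] at hb1 hb2
  set r := √(x j ^ 2 + x k ^ 2)
  have hrot : rot (ON2_ee hjk) (b - a) x = x' := by
    ext l
    rw [rot_apply]
    simp only [PiLp.add_apply, PiLp.smul_apply, inner_ee, smul_eq_mul]
    have sc := sin_sq_add_cos_sq a
    rcases hl l with rfl | rfl | rfl
    · simp [ee, hij, hik, he]
    · simp only [ee, EuclideanSpace.single_apply, if_true, if_neg hjk]
      rw [hb1, ha1, ha2, cos_sub, sin_sub]
      linear_combination (r * cos b) * sc
    · simp only [ee, EuclideanSpace.single_apply, if_true, if_neg hjk.symm]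
      rw [hb2, ha1, ha2, cos_sub, sin_sub]
      linear_combination (r * sin b) * sc
  have hd : ∀ θ, HasDerivAt (fun θ => F (rot (ON2_ee hjk) θ x)) 0 θ := fun θ => by
    have := h.F_der (ON2_ee hjk) hx θ
    rwa [hz _ (R_mem _ hx)] at this
  have := is_const_of_deriv_eq_zero (fun θ => (hd θ).differentiableAt) (fun θ => (hd θ).deriv) 0 (b - a)
  simp only [rot_zero, hrot] at this
  exact this

lemma axis (h : Sol lam F G H) (hd : ∀ i j, i ≠ j → QF F (ee i) (ee j) = 0) :
    ∃ i : Fin 3, ∀ x ∈ S3, ∀ x' ∈ S3, x i = x' i → F x = F x' := by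
  have he := h.even hd
  have E01 := h.EP he (j := 0) (k := 1) (by decide)
  have E12 := h.EP he (j := 1) (k := 2) (by decide)
  have E20 := h.EP he (j := 2) (k := 0) (by decide)
  set a := ph G (ee 0) (ee 1)
  set b := ph G (ee 1) (ee 2)
  set c := ph G (ee 2) (ee 0)
  by_cases ha : ∀ x ∈ S3, a x = 0
  · exact ⟨2, fun x hx x' hx' e => h.sym_of_zero (by decide) (by decide) (by decide) ha hx hx' e⟩
  by_cases hb : ∀ x ∈ S3, b x = 0
  · exact ⟨0, fun x hx x' hx' e => h.sym_of_zero (by decide) (by decide) (by decide) hb hx hx' e⟩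
  by_cases hc : ∀ x ∈ S3, c x = 0
  · exact ⟨1, fun x hx x' hx' e => h.sym_of_zero (by decide) (by decide) (by decide) hc hx hx' e⟩
  exfalso
  have htri := h.trilin (ON2_ee (i := 0) (j := 1) (by decide)) (ON2_ee (i := 1) (j := 2) (by decide)) (ON2_ee (i := 2) (j := 0) (by decide))
  have hl := h.two
  have hcont : ContinuousOn (fun x => lam * Real.exp (F x) * a x * b x * c x) S3 :=
    ((E01.cf.mul E01.cc.contG).mul E12.cc.contG).mul E20.cc.contG
  have hsg : ∀ x ∈ S3, a x * b x * c x * (x 0 * x 1 * x 2)^2 = (a x * (x 0 * x 1)) * (b x * (x 1 * x 2)) * (c x * (x 2 * x 0)) := by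
    intro x hx; ring
  have hz0 : ∀ x ∈ S3, x 0 * x 1 * x 2 = 0 → a x * b x * c x = 0 := by
    intro x hx h0
    rcases mul_eq_zero.mp h0 with h1 | h1
    · rw [E01.zero hx h1]; simp
    · rw [E12.zero hx (by rw [h1]; simp)]; simp
  have hsign : (∀ x ∈ S3, 0 ≤ a x * b x * c x) ∨ (∀ x ∈ S3, a x * b x * c x ≤ 0) := by
    have hp : ∀ x ∈ S3, 0 ≤ (a x * (x 0 * x 1)) * (b x * (x 1 * x 2)) * (c x * (x 2 * x 0)) → 0 ≤ a x * b x * c x := by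
      intro x hx h0
      rw [← hsg x hx] at h0
      by_cases h1 : x 0 * x 1 * x 2 = 0
      · rw [hz0 x hx h1]
      · exact nonneg_of_mul_nonneg_left h0 (by positivity)
    have hm : ∀ x ∈ S3, (a x * (x 0 * x 1)) * (b x * (x 1 * x 2)) * (c x * (x 2 * x 0)) ≤ 0 → a x * b x * c x ≤ 0 := by
      intro x hx h0
      rw [← hsg x hx] at h0
      by_cases h1 : x 0 * x 1 * x 2 = 0
      · rw [hz0 x hx h1]
      · exact nonpos_of_mul_nonpos_left h0 (by positivity)
    rcases E01.sign with s1 | s1 <;> rcases E12.sign with s2 | s2 <;> rcases E20.sign with s3 | s3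
    · exact Or.inl fun x hx => hp x hx (mul_nonneg (mul_nonneg (s1 x hx) (s2 x hx)) (s3 x hx))
    · exact Or.inr fun x hx => hm x hx (mul_nonpos_of_nonneg_of_nonpos (mul_nonneg (s1 x hx) (s2 x hx)) (s3 x hx))
    · exact Or.inr fun x hx => hm x hx (mul_nonpos_of_nonpos_of_nonneg (mul_nonpos_of_nonneg_of_nonpos (s1 x hx) (s2 x hx)) (s3 x hx))
    · exact Or.inl fun x hx => hp x hx (mul_nonneg_of_nonpos_of_nonpos (mul_nonpos_of_nonneg_of_nonpos (s1 x hx) (s2 x hx)) (s3 x hx))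
    · exact Or.inr fun x hx => hm x hx (mul_nonpos_of_nonpos_of_nonneg (mul_nonpos_of_nonpos_of_nonneg (s1 x hx) (s2 x hx)) (s3 x hx))
    · exact Or.inl fun x hx => hp x hx (mul_nonneg_of_nonpos_of_nonpos (mul_nonpos_of_nonpos_of_nonneg (s1 x hx) (s2 x hx)) (s3 x hx))
    · exact Or.inl fun x hx => hp x hx (mul_nonneg (mul_nonneg_of_nonpos_of_nonpos (s1 x hx) (s2 x hx)) (s3 x hx))
    · exact Or.inr fun x hx => hm x hx (mul_nonpos_of_nonneg_of_nonpos (mul_nonneg_of_nonpos_of_nonpos (s1 x hx) (s2 x hx)) (s3 x hx))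
  have hall : ∀ x ∈ S3, lam * Real.exp (F x) * a x * b x * c x = 0 := by
    rcases hsign with hs | hs
    · refine int_pos_zero hcont (fun x hx => ?_) htri.le
      have := mul_nonneg (E01.f0 x hx).le (hs x hx)
      linarith
    · have := int_pos_zero hcont.neg (fun x hx => ?_) (le_of_eq (by
        change ∫ x, - (lam * Real.exp (F x) * a x * b x * c x) ∂sig = 0
        rw [integral_neg, htri, neg_zero]))
      · intro x hx
        have := this x hx
        exact neg_eq_zero.mp this
      · have := mul_nonneg (E01.f0 x hx).le (neg_nonneg.mpr (hs x hx))
        change 0 ≤ - (lam * Real.exp (F x) * a x * b x * c x)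
        linarith
  -- a base point
  obtain ⟨y, hy, hy0⟩ : ∃ y : E3, y ∈ S3 ∧ y 0 * y 1 * y 2 ≠ 0 := by
    refine ⟨nrmz (ee 0 + ee 1 + ee 2), nrmz_mem ?_, ?_⟩
    · intro h0
      have := congrArg (fun v : E3 => v 0) h0
      simp [ee] at this
    · have hn0 : (ee 0 + ee 1 + ee 2 : E3) ≠ 0 := by
        intro h0
        have := congrArg (fun v : E3 => v 0) h0
        simp [ee] at this
      have : ‖(ee 0 + ee 1 + ee 2 : E3)‖ ≠ 0 := norm_ne_zero_iff.mpr hn0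
      unfold nrmz
      generalize ‖(ee 0 + ee 1 + ee 2 : E3)‖ = n at *
      simp [ee, this]
  have hU : ∀ y ∈ S3, y 0 * y 1 * y 2 ≠ 0 → ∀ᶠ x in nhdsWithin y S3, x 0 * x 1 * x 2 ≠ 0 := by
    intro y _ h0
    have hcn : Continuous (fun x : E3 => x 0 * x 1 * x 2) := by fun_prop
    exact mem_nhdsWithin_of_mem_nhds (hcn.continuousAt.eventually_ne h0)
  have hs : ∀ y, ∀ᶠ x in nhdsWithin y S3, x ∈ S3 := fun y => self_mem_nhdsWithin
  have hmul : ∀ y : E3, y 0 * y 1 * y 2 ≠ 0 → y 0 * y 1 ≠ 0 ∧ y 1 * y 2 ≠ 0 ∧ y 2 * y 0 ≠ 0 := by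
    intro y h0
    refine ⟨fun h1 => h0 (by rw [h1, zero_mul]), fun h1 => h0 (by rw [mul_assoc, h1, mul_zero]), fun h1 => h0 (by linear_combination y 1 * h1)⟩
  obtain ⟨x1, h1a, h1u, h1s⟩ := ((E01.freq ha hy (hmul y hy0).1).and_eventually ((hU y hy hy0).and (hs y))).exists
  obtain ⟨x2, h2b, h2u, h2s, h2a⟩ := ((E12.freq hb h1s (hmul x1 h1u).2.1).and_eventually
    ((hU x1 h1s h1u).and ((hs x1).and ((E01.cc.contG x1 h1s).eventually_ne h1a)))).exists
  obtain ⟨x3, h3c, h3s, h3a, h3b⟩ := ((E20.freq hc h2s (hmul x2 h2u).2.2).and_eventually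
    ((hs x2).and (((E01.cc.contG x2 h2s).eventually_ne h2a).and ((E12.cc.contG x2 h2s).eventually_ne h2b)))).exists
  exact mul_ne_zero (mul_ne_zero (mul_ne_zero (E01.f0 x3 h3s).ne' h3a) h3b) h3c (hall x3 h3s)

end Sol


/-! ### From the stereographic charts to the homogeneous extension -/

/-- The two stereographic charts, `s = 1` and `s = -1`. -/
def sg (s : ℝ) (y : ℝ × ℝ) : E3 :=
  !₂[2 * y.1 / (1 + y.1 ^ 2 + y.2 ^ 2), 2 * y.2 / (1 + y.1 ^ 2 + y.2 ^ 2),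
    s * (1 - 2 / (1 + y.1 ^ 2 + y.2 ^ 2))]

lemma sg_zero (s : ℝ) (y : ℝ × ℝ) : sg s y 0 = 2 * y.1 / (1 + y.1 ^ 2 + y.2 ^ 2) := rfl
lemma sg_one (s : ℝ) (y : ℝ × ℝ) : sg s y 1 = 2 * y.2 / (1 + y.1 ^ 2 + y.2 ^ 2) := rfl
lemma sg_two (s : ℝ) (y : ℝ × ℝ) : sg s y 2 = s * (1 - 2 / (1 + y.1 ^ 2 + y.2 ^ 2)) := rfl

lemma E3_ext {x y : E3} (h0 : x 0 = y 0) (h1 : x 1 = y 1) (h2 : x 2 = y 2) : x = y := by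
  ext i; fin_cases i
  · exact h0
  · exact h1
  · exact h2

lemma dpos (a b : ℝ) : 0 < 1 + a ^ 2 + b ^ 2 := by positivity

lemma norm_sq3 (x : E3) : ‖x‖ ^ 2 = x 0 ^ 2 + x 1 ^ 2 + x 2 ^ 2 := by
  rw [← real_inner_self_eq_norm_sq, inner3]; ring

lemma S3_of_sq {x : E3} (h : x 0 ^ 2 + x 1 ^ 2 + x 2 ^ 2 = 1) : x ∈ S3 := by
  rw [mem_S3]
  have := norm_sq3 x
  rw [h] at this
  have h0 := norm_nonneg x
  nlinarith

lemma sg_mem {s : ℝ} (hs : s ^ 2 = 1) (y : ℝ × ℝ) : sg s y ∈ S3 := by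
  apply S3_of_sq
  rw [sg_zero, sg_one, sg_two, mul_pow s, hs]
  have := (dpos y.1 y.2).ne'
  field_simp
  ring

lemma sg_N (y : ℝ × ℝ) : (sg 1 y).ofLp = stereoN y := by
  have := (dpos y.1 y.2).ne'
  ext i; fin_cases i
  · rfl
  · rfl
  · change (1:ℝ) * (1 - 2 / (1 + y.1 ^ 2 + y.2 ^ 2)) = (y.1 ^ 2 + y.2 ^ 2 - 1) / (1 + y.1 ^ 2 + y.2 ^ 2)
    field_simp; ring

lemma sg_S (y : ℝ × ℝ) : (sg (-1) y).ofLp = stereoS y := by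
  have := (dpos y.1 y.2).ne'
  ext i; fin_cases i
  · rfl
  · rfl
  · change (-1:ℝ) * (1 - 2 / (1 + y.1 ^ 2 + y.2 ^ 2)) = (1 - y.1 ^ 2 - y.2 ^ 2) / (1 + y.1 ^ 2 + y.2 ^ 2)
    field_simp; ring

lemma sg_inv_eq {s : ℝ} (hs : s ^ 2 = 1) {z : E3} (hz : z ≠ 0) (hd : ‖z‖ - s * z 2 ≠ 0) :
    sg s (z 0 / (‖z‖ - s * z 2), z 1 / (‖z‖ - s * z 2)) = nrmz z := by
  have hn : ‖z‖ ≠ 0 := norm_ne_zero_iff.mpr hz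
  have h1 := norm_sq3 z
  have hD : 1 + (z 0 / (‖z‖ - s * z 2)) ^ 2 + (z 1 / (‖z‖ - s * z 2)) ^ 2 = 2 * ‖z‖ / (‖z‖ - s * z 2) := by
    field_simp
    linear_combination (-1) * h1 + z 2 ^ 2 * hs
  refine E3_ext ?_ ?_ ?_
  · rw [sg_zero]; simp only [hD, nrmz, PiLp.smul_apply, smul_eq_mul]; field_simp
  · rw [sg_one]; simp only [hD, nrmz, PiLp.smul_apply, smul_eq_mul]; field_simp
  · rw [sg_two]; simp only [hD, nrmz, PiLp.smul_apply, smul_eq_mul]; field_simp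
    linear_combination z 2 * hs

lemma sg_cover {z : E3} (hz : z ≠ 0) : ∃ s : ℝ, (s = 1 ∨ s = -1) ∧ ‖z‖ - s * z 2 ≠ 0 := by
  by_cases h : ‖z‖ - 1 * z 2 ≠ 0
  · exact ⟨1, Or.inl rfl, h⟩
  · refine ⟨-1, Or.inr rfl, fun h' => ?_⟩
    rw [not_not] at h
    have : ‖z‖ = 0 := by linarith
    exact hz (norm_eq_zero.mp this)

lemma hasDerivAt_E3 {f : ℝ → E3} {f' : E3} {t : ℝ} (h0 : HasDerivAt (fun r => f r 0) (f' 0) t)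
    (h1 : HasDerivAt (fun r => f r 1) (f' 1) t) (h2 : HasDerivAt (fun r => f r 2) (f' 2) t) :
    HasDerivAt f f' t := by
  have h := ((h0.smul_const (ee 0)).fun_add (h1.smul_const (ee 1))).fun_add (h2.smul_const (ee 2))
  rw [← decomp3 f'] at h
  refine h.congr_of_eventuallyEq (Filter.Eventually.of_forall fun r => ?_)
  exact decomp3 (f r)

def sga (s : ℝ) (y : ℝ × ℝ) : E3 :=
  !₂[2 / (1 + y.1 ^ 2 + y.2 ^ 2) - 4 * y.1 ^ 2 / (1 + y.1 ^ 2 + y.2 ^ 2) ^ 2,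
    - 4 * y.1 * y.2 / (1 + y.1 ^ 2 + y.2 ^ 2) ^ 2, s * (4 * y.1 / (1 + y.1 ^ 2 + y.2 ^ 2) ^ 2)]
def sgb (s : ℝ) (y : ℝ × ℝ) : E3 :=
  !₂[- 4 * y.1 * y.2 / (1 + y.1 ^ 2 + y.2 ^ 2) ^ 2,
    2 / (1 + y.1 ^ 2 + y.2 ^ 2) - 4 * y.2 ^ 2 / (1 + y.1 ^ 2 + y.2 ^ 2) ^ 2,
    s * (4 * y.2 / (1 + y.1 ^ 2 + y.2 ^ 2) ^ 2)]
def sgaa (s : ℝ) (y : ℝ × ℝ) : E3 :=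
  !₂[- 12 * y.1 / (1 + y.1 ^ 2 + y.2 ^ 2) ^ 2 + 16 * y.1 ^ 3 / (1 + y.1 ^ 2 + y.2 ^ 2) ^ 3,
    - 4 * y.2 / (1 + y.1 ^ 2 + y.2 ^ 2) ^ 2 + 16 * y.1 ^ 2 * y.2 / (1 + y.1 ^ 2 + y.2 ^ 2) ^ 3,
    s * (4 / (1 + y.1 ^ 2 + y.2 ^ 2) ^ 2 - 16 * y.1 ^ 2 / (1 + y.1 ^ 2 + y.2 ^ 2) ^ 3)]
def sgbb (s : ℝ) (y : ℝ × ℝ) : E3 :=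
  !₂[- 4 * y.1 / (1 + y.1 ^ 2 + y.2 ^ 2) ^ 2 + 16 * y.2 ^ 2 * y.1 / (1 + y.1 ^ 2 + y.2 ^ 2) ^ 3,
    - 12 * y.2 / (1 + y.1 ^ 2 + y.2 ^ 2) ^ 2 + 16 * y.2 ^ 3 / (1 + y.1 ^ 2 + y.2 ^ 2) ^ 3,
    s * (4 / (1 + y.1 ^ 2 + y.2 ^ 2) ^ 2 - 16 * y.2 ^ 2 / (1 + y.1 ^ 2 + y.2 ^ 2) ^ 3)]

lemma dA (a b : ℝ) : HasDerivAt (fun t : ℝ => 1 + t ^ 2 + b ^ 2) (2 * a) a := by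
  simpa using (((hasDerivAt_id a).pow 2).const_add 1).add_const (b ^ 2)
lemma dB (a b : ℝ) : HasDerivAt (fun t : ℝ => 1 + a ^ 2 + t ^ 2) (2 * b) b := by
  simpa using (((hasDerivAt_id b).pow 2).const_add (1 + a ^ 2))

/-- derivative of `p t / D t ^ k`. -/
lemma dquot {p D : ℝ → ℝ} {p' D' t : ℝ} (k : ℕ) (hp : HasDerivAt p p' t) (hD : HasDerivAt D D' t)
    (h0 : D t ≠ 0) : HasDerivAt (fun r => p r / D r ^ k) (p' / D t ^ k - k * p t * D' / D t ^ (k + 1)) t := by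
  have h := hp.fun_div (hD.fun_pow k) (pow_ne_zero k h0)
  refine h.congr_deriv ?_
  rcases k with _ | k
  · simp
  · simp only [Nat.add_sub_cancel, pow_succ]
    field_simp

lemma der_sg_a (s a b : ℝ) : HasDerivAt (fun t => sg s (t, b)) (sga s (a, b)) a := by
  have hne := (dpos a b).ne'
  refine hasDerivAt_E3 ?_ ?_ ?_
  · have := dquot 1 ((hasDerivAt_id a).const_mul 2) (dA a b) hne
    simp only [pow_one, id] at this
    refine HasDerivAt.congr_deriv this ?_
    simp only [sga, Matrix.cons_val_zero, Matrix.cons_val_one, Matrix.cons_val]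
    push_cast; ring
  · have := dquot 1 (hasDerivAt_const a (2 * b)) (dA a b) hne
    simp only [pow_one] at this
    refine HasDerivAt.congr_deriv this ?_
    simp only [sga, Matrix.cons_val_zero, Matrix.cons_val_one, Matrix.cons_val]
    push_cast; ring
  · have := ((dquot 1 (hasDerivAt_const a 2) (dA a b) hne).const_sub 1).const_mul s
    simp only [pow_one] at this
    refine HasDerivAt.congr_deriv this ?_
    simp only [sga, Matrix.cons_val_zero, Matrix.cons_val_one, Matrix.cons_val]
    push_cast; ring

lemma der_sg_b (s a b : ℝ) : HasDerivAt (fun t => sg s (a, t)) (sgb s (a, b)) b := by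
  have hne := (dpos a b).ne'
  refine hasDerivAt_E3 ?_ ?_ ?_
  · have := dquot 1 (hasDerivAt_const b (2 * a)) (dB a b) hne
    simp only [pow_one] at this
    refine HasDerivAt.congr_deriv this ?_
    simp only [sgb, Matrix.cons_val_zero, Matrix.cons_val_one, Matrix.cons_val]
    push_cast; ring
  · have := dquot 1 ((hasDerivAt_id b).const_mul 2) (dB a b) hne
    simp only [pow_one, id] at this
    refine HasDerivAt.congr_deriv this ?_
    simp only [sgb, Matrix.cons_val_zero, Matrix.cons_val_one, Matrix.cons_val]
    push_cast; ring
  · have := ((dquot 1 (hasDerivAt_const b 2) (dB a b) hne).const_sub 1).const_mul s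
    simp only [pow_one] at this
    refine HasDerivAt.congr_deriv this ?_
    simp only [sgb, Matrix.cons_val_zero, Matrix.cons_val_one, Matrix.cons_val]
    push_cast; ring

lemma der_sga_a (s a b : ℝ) : HasDerivAt (fun t => sga s (t, b)) (sgaa s (a, b)) a := by
  have hne := (dpos a b).ne'
  refine hasDerivAt_E3 ?_ ?_ ?_
  · have := (dquot 1 (hasDerivAt_const a 2) (dA a b) hne).fun_sub
      (dquot 2 (((hasDerivAt_id a).fun_pow 2).const_mul 4) (dA a b) hne)
    simp only [pow_one, id] at this
    refine HasDerivAt.congr_deriv this ?_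
    simp only [sgaa, Matrix.cons_val_zero, Matrix.cons_val_one, Matrix.cons_val]
    push_cast; ring
  · have := dquot 2 (((hasDerivAt_id a).const_mul (-4)).mul_const b) (dA a b) hne
    simp only [id] at this
    refine HasDerivAt.congr_deriv this ?_
    simp only [sgaa, Matrix.cons_val_zero, Matrix.cons_val_one, Matrix.cons_val]
    push_cast; ring
  · have := (dquot 2 ((hasDerivAt_id a).const_mul 4) (dA a b) hne).const_mul s
    simp only [id] at this
    refine HasDerivAt.congr_deriv this ?_
    simp only [sgaa, Matrix.cons_val_zero, Matrix.cons_val_one, Matrix.cons_val]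
    push_cast; ring

lemma der_sgb_b (s a b : ℝ) : HasDerivAt (fun t => sgb s (a, t)) (sgbb s (a, b)) b := by
  have hne := (dpos a b).ne'
  refine hasDerivAt_E3 ?_ ?_ ?_
  · have := dquot 2 (((hasDerivAt_id b)).const_mul (-4 * a)) (dB a b) hne
    simp only [id] at this
    refine HasDerivAt.congr_deriv this ?_
    simp only [sgbb, Matrix.cons_val_zero, Matrix.cons_val_one, Matrix.cons_val]
    push_cast; ring
  · have := (dquot 1 (hasDerivAt_const b 2) (dB a b) hne).fun_sub
      (dquot 2 (((hasDerivAt_id b).fun_pow 2).const_mul 4) (dB a b) hne)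
    simp only [pow_one, id] at this
    refine HasDerivAt.congr_deriv this ?_
    simp only [sgbb, Matrix.cons_val_zero, Matrix.cons_val_one, Matrix.cons_val]
    push_cast; ring
  · have := (dquot 2 ((hasDerivAt_id b).const_mul 4) (dB a b) hne).const_mul s
    simp only [id] at this
    refine HasDerivAt.congr_deriv this ?_
    simp only [sgbb, Matrix.cons_val_zero, Matrix.cons_val_one, Matrix.cons_val]
    push_cast; ring

lemma sg_lap {s : ℝ} (hs : s ^ 2 = 1) (y : ℝ × ℝ) (g : E3) (H : E3 →L[ℝ] E3) :
    inner ℝ (H (sga s y)) (sga s y) + inner ℝ g (sgaa s y) + (inner ℝ (H (sgb s y)) (sgb s y) + inner ℝ g (sgbb s y))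
      = 4 / (1 + y.1 ^ 2 + y.2 ^ 2) ^ 2 * SL (sg s y) g H := by
  have hH : ∀ v w : E3, inner ℝ (H v) w = v 0 * (w 0 * H (ee 0) 0 + w 1 * H (ee 0) 1 + w 2 * H (ee 0) 2)
      + v 1 * (w 0 * H (ee 1) 0 + w 1 * H (ee 1) 1 + w 2 * H (ee 1) 2)
      + v 2 * (w 0 * H (ee 2) 0 + w 1 * H (ee 2) 1 + w 2 * H (ee 2) 2) := by
    intro v w
    conv_lhs => rw [decomp3 v]
    simp only [map_add, map_smul, inner3, PiLp.add_apply, PiLp.smul_apply, smul_eq_mul]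
    ring
  unfold SL
  rw [hH, hH, hH, inner3 g, inner3 g, inner3 g]
  obtain ⟨a, b⟩ := y
  have hne := (dpos a b).ne'
  generalize H (ee 0) 0 = h00
  generalize H (ee 0) 1 = h01
  generalize H (ee 0) 2 = h02
  generalize H (ee 1) 0 = h10
  generalize H (ee 1) 1 = h11
  generalize H (ee 1) 2 = h12
  generalize H (ee 2) 0 = h20
  generalize H (ee 2) 1 = h21
  generalize H (ee 2) 2 = h22
  generalize g 0 = g0
  generalize g 1 = g1
  generalize g 2 = g2
  simp only [sg, sga, sgb, sgaa, sgbb, Matrix.cons_val_zero, Matrix.cons_val_one, Matrix.cons_val]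
  obtain rfl | rfl := (show s = 1 ∨ s = -1 by simpa using hs)
  · field_simp
    ring
  · field_simp
    ring

/-- A zero-homogeneous function that solves the equation in both charts. -/
structure Chart (lam : ℝ) (F : E3 → ℝ) : Prop where
  hom : ∀ z : E3, z ≠ 0 → F (nrmz z) = F z
  cd : ∀ s : ℝ, s = 1 ∨ s = -1 → ContDiff ℝ 2 (fun y => F (sg s y))
  eq : ∀ s : ℝ, s = 1 ∨ s = -1 → ∀ y : ℝ × ℝ, lap (fun y => F (sg s y)) y =
    4 * lam * (1 - Real.exp (F (sg s y))) / (1 + y.1 ^ 2 + y.2 ^ 2) ^ 2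

namespace Chart
variable {lam : ℝ} {F : E3 → ℝ}

lemma contDiffAt (h : Chart lam F) {x : E3} (hx : x ≠ 0) : ContDiffAt ℝ 2 F x := by
  obtain ⟨s, hs, hd⟩ := sg_cover hx
  have hs2 : s ^ 2 = 1 := by rcases hs with rfl | rfl <;> norm_num
  have hcoord : ∀ i : Fin 3, ContDiffAt ℝ 2 (fun z : E3 => z i) x := fun i =>
    contDiffAt_euclidean.mp contDiffAt_id i
  have hden : ContDiffAt ℝ 2 (fun z : E3 => ‖z‖ - s * z 2) x :=
    (contDiffAt_norm ℝ hx).sub (contDiffAt_const.mul (hcoord 2))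
  have hinner : ContDiffAt ℝ 2 (fun z : E3 => (z 0 / (‖z‖ - s * z 2), z 1 / (‖z‖ - s * z 2))) x :=
    ((hcoord 0).div hden hd).prodMk ((hcoord 1).div hden hd)
  have hc := ContDiffAt.comp x ((h.cd s hs).contDiffAt) hinner
  refine hc.congr_of_eventuallyEq ?_
  filter_upwards [isOpen_ne.mem_nhds hx, hden.continuousAt.eventually_ne hd] with z hz hzd
  simp only [Function.comp]
  rw [sg_inv_eq hs2 hz hzd, h.hom z hz]

lemma diffAt (h : Chart lam F) {x : E3} (hx : x ≠ 0) : DifferentiableAt ℝ F x :=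
  (h.contDiffAt hx).differentiableAt (by norm_num)

lemma inner_grad (h : Chart lam F) {x : E3} (v : E3) : inner ℝ (gradient F x) v = fderiv ℝ F x v := by
  simp [gradient]

lemma contDiffAt_grad (h : Chart lam F) {x : E3} (hx : x ≠ 0) : ContDiffAt ℝ 1 (gradient F) x := by
  have h1 : ContDiffAt ℝ 1 (fderiv ℝ F) x := (h.contDiffAt hx).fderiv_right (by norm_num)
  exact (InnerProductSpace.toDual ℝ E3).symm.contDiff.contDiffAt.comp x h1

lemma hasF (h : Chart lam F) {x : E3} (hx : x ≠ 0) : HasFDerivAt F (innerSL ℝ (gradient F x)) x := by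
  have := (h.diffAt hx).hasGradientAt.hasFDerivAt
  exact this

lemma hasG (h : Chart lam F) {x : E3} (hx : x ≠ 0) : HasFDerivAt (gradient F) (fderiv ℝ (gradient F) x) x :=
  ((h.contDiffAt_grad hx).differentiableAt (by norm_num)).hasFDerivAt

lemma S3_ne {x : E3} (hx : x ∈ S3) : x ≠ 0 := by
  rintro rfl; simp [mem_S3] at hx

lemma c2 (h : Chart lam F) : C2 F (gradient F) (fderiv ℝ (gradient F)) where
  c1 := ⟨fun x hx => (h.contDiffAt_grad (S3_ne hx)).continuousAt.continuousWithinAt, fun x hx => h.hasF (S3_ne hx)⟩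
  der x hx := h.hasG (S3_ne hx)
  cont x hx := by
    have h1 : ContDiffAt ℝ 0 (fderiv ℝ (gradient F)) x := (h.contDiffAt_grad (S3_ne hx)).fderiv_right (by norm_num)
    exact h1.continuousAt.continuousWithinAt

lemma sym (h : Chart lam F) {x : E3} (hx : x ≠ 0) (a b : E3) :
    inner ℝ (fderiv ℝ (gradient F) x a) b = (inner ℝ a (fderiv ℝ (gradient F) x b) : ℝ) := by
  have h1 : ContDiffAt ℝ 1 (fderiv ℝ F) x := (h.contDiffAt hx).fderiv_right (by norm_num)
  have key : ∀ a b : E3, inner ℝ (fderiv ℝ (gradient F) x a) b = fderiv ℝ (fderiv ℝ F) x a b := by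
    intro a b
    have e1 : HasFDerivAt (fun z => fderiv ℝ F z b) ((ContinuousLinearMap.apply ℝ ℝ b).comp (fderiv ℝ (fderiv ℝ F) x)) x :=
      (ContinuousLinearMap.apply ℝ ℝ b).hasFDerivAt.comp x (h1.differentiableAt (by norm_num)).hasFDerivAt
    have e2 : HasFDerivAt (fun z => fderiv ℝ F z b) ((innerSL ℝ b).comp (fderiv ℝ (gradient F) x)) x := by
      have := (innerSL ℝ b).hasFDerivAt.comp x (h.hasG hx)
      refine this.congr_of_eventuallyEq (Filter.Eventually.of_forall fun z => ?_)
      simp only [Function.comp, innerSL_apply_apply]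
      rw [real_inner_comm, h.inner_grad]
    have := DFunLike.congr_fun (e1.unique e2) a
    simp only [ContinuousLinearMap.comp_apply, ContinuousLinearMap.apply_apply, innerSL_apply_apply] at this
    rw [real_inner_comm, ← this]
  have hsym := (h.contDiffAt hx).isSymmSndFDerivAt (by simp)
  rw [key, real_inner_comm, key]
  exact hsym a b

lemma rad (h : Chart lam F) {x : E3} (hx : x ≠ 0) : inner ℝ x (gradient F x) = (0:ℝ) := by
  have h1 : HasDerivAt (fun t : ℝ => t • x) x 1 := by
    simpa using (hasDerivAt_id (1:ℝ)).smul_const x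
  have h2 : HasFDerivAt F (innerSL ℝ (gradient F x)) ((1:ℝ) • x) := by rw [one_smul]; exact h.hasF hx
  have h3 := h2.comp_hasDerivAt (1:ℝ) h1
  have h4 : HasDerivAt (F ∘ fun t : ℝ => t • x) 0 1 := by
    refine (hasDerivAt_const (1:ℝ) (F x)).congr_of_eventuallyEq ?_
    filter_upwards [lt_mem_nhds (zero_lt_one : (0:ℝ) < 1)] with t ht
    simp only [Function.comp]
    rw [← h.hom x hx, ← h.hom (t • x) (smul_ne_zero ht.ne' hx)]
    congr 1
    simp only [nrmz, norm_smul, Real.norm_eq_abs, abs_of_pos ht, smul_smul]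
    congr 1
    field_simp
  have h5 := h3.unique h4
  rw [innerSL_apply_apply] at h5
  rw [real_inner_comm]; exact h5

lemma Hx (h : Chart lam F) {x : E3} (hx : x ≠ 0) : fderiv ℝ (gradient F) x x = - gradient F x := by
  have e1 := (hasFDerivAt_id (𝕜 := ℝ) x).inner ℝ (h.hasG hx)
  have e2 : HasFDerivAt (fun z : E3 => (inner ℝ (id z) (gradient F z) : ℝ)) (0 : E3 →L[ℝ] ℝ) x := by
    refine (hasFDerivAt_const (0:ℝ) x).congr_of_eventuallyEq ?_
    filter_upwards [isOpen_ne.mem_nhds hx] with z hz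
    exact h.rad hz
  have e := e1.unique e2
  refine ext_inner_right ℝ fun v => ?_
  have e3 := DFunLike.congr_fun e v
  simp at e3
  rw [h.sym hx, inner_neg_left, h.inner_grad]
  linarith

lemma lap_eq (h : Chart lam F) {s : ℝ} (hs : s = 1 ∨ s = -1) (y : ℝ × ℝ) :
    lap (fun y => F (sg s y)) y = 4 / (1 + y.1 ^ 2 + y.2 ^ 2) ^ 2 *
      SL (sg s y) (gradient F (sg s y)) (fderiv ℝ (gradient F) (sg s y)) := by
  have hs2 : s ^ 2 = 1 := by rcases hs with rfl | rfl <;> norm_num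
  rw [← sg_lap hs2]
  obtain ⟨a, b⟩ := y
  have hw := h.cd s hs
  have hne : ∀ y, sg s y ≠ 0 := fun y => S3_ne (sg_mem hs2 y)
  have hw1 : ∀ y, HasFDerivAt (fun y => F (sg s y)) (fderiv ℝ (fun y => F (sg s y)) y) y := fun y =>
    (hw.differentiable (by norm_num) y).hasFDerivAt
  have hw2 : HasFDerivAt (fderiv ℝ (fun y => F (sg s y))) (fderiv ℝ (fderiv ℝ (fun y => F (sg s y))) (a, b)) (a, b) :=
    (((hw.fderiv_right (m := 1) (by norm_num)).differentiable (by norm_num)) (a, b)).hasFDerivAt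
  have pa : ∀ a b : ℝ, HasDerivAt (fun t : ℝ => (t, b)) ((1:ℝ), (0:ℝ)) a := fun a b =>
    (hasDerivAt_id a).prodMk (hasDerivAt_const a b)
  have pb : ∀ a b : ℝ, HasDerivAt (fun t : ℝ => (a, t)) ((0:ℝ), (1:ℝ)) b := fun a b =>
    (hasDerivAt_const b a).prodMk (hasDerivAt_id b)
  have fa : ∀ a b : ℝ, fderiv ℝ (fun y => F (sg s y)) (a, b) (1, 0) = inner ℝ (gradient F (sg s (a, b))) (sga s (a, b)) := by
    intro a b
    have e1 := (hw1 (a, b)).comp_hasDerivAt a (pa a b)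
    have e2 := (h.hasF (hne (a, b))).comp_hasDerivAt a (der_sg_a s a b)
    exact e1.unique e2
  have fb : ∀ a b : ℝ, fderiv ℝ (fun y => F (sg s y)) (a, b) (0, 1) = inner ℝ (gradient F (sg s (a, b))) (sgb s (a, b)) := by
    intro a b
    have e1 := (hw1 (a, b)).comp_hasDerivAt b (pb a b)
    have e2 := (h.hasF (hne (a, b))).comp_hasDerivAt b (der_sg_b s a b)
    exact e1.unique e2
  have ga : fderiv ℝ (fderiv ℝ (fun y => F (sg s y))) (a, b) (1, 0) (1, 0) =
      inner ℝ (fderiv ℝ (gradient F) (sg s (a, b)) (sga s (a, b))) (sga s (a, b))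
        + inner ℝ (gradient F (sg s (a, b))) (sgaa s (a, b)) := by
    have e1 := (ContinuousLinearMap.apply ℝ ℝ ((1:ℝ), (0:ℝ))).hasFDerivAt.comp_hasDerivAt a
      (hw2.comp_hasDerivAt a (pa a b))
    have e2 := ((h.hasG (hne (a, b))).comp_hasDerivAt a (der_sg_a s a b)).inner ℝ (der_sga_a s a b)
    have e3 := e1.unique (e2.congr_of_eventuallyEq (Filter.Eventually.of_forall fun t => fa t b))
    simp only [ContinuousLinearMap.apply_apply, Function.comp] at e3
    rw [e3, add_comm]
  have gb : fderiv ℝ (fderiv ℝ (fun y => F (sg s y))) (a, b) (0, 1) (0, 1) =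
      inner ℝ (fderiv ℝ (gradient F) (sg s (a, b)) (sgb s (a, b))) (sgb s (a, b))
        + inner ℝ (gradient F (sg s (a, b))) (sgbb s (a, b)) := by
    have e1 := (ContinuousLinearMap.apply ℝ ℝ ((0:ℝ), (1:ℝ))).hasFDerivAt.comp_hasDerivAt b
      (hw2.comp_hasDerivAt b (pb a b))
    have e2 := ((h.hasG (hne (a, b))).comp_hasDerivAt b (der_sg_b s a b)).inner ℝ (der_sgb_b s a b)
    have e3 := e1.unique (e2.congr_of_eventuallyEq (Filter.Eventually.of_forall fun t => fb a t))
    simp only [ContinuousLinearMap.apply_apply, Function.comp] at e3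
    rw [e3, add_comm]
  unfold lap
  rw [iteratedFDeriv_two_apply, iteratedFDeriv_two_apply]
  simp only [Matrix.cons_val_zero, Matrix.cons_val_one]
  rw [ga, gb]

lemma SL_eq (h : Chart lam F) {x : E3} (hx : x ∈ S3) :
    SL x (gradient F x) (fderiv ℝ (gradient F) x) = lam * (1 - Real.exp (F x)) := by
  obtain ⟨s, hs, hd⟩ := sg_cover (S3_ne hx)
  have hs2 : s ^ 2 = 1 := by rcases hs with rfl | rfl <;> norm_num
  have he := sg_inv_eq hs2 (S3_ne hx) hd
  rw [nrmz_of_mem hx] at he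
  generalize (x 0 / (‖x‖ - s * x 2), x 1 / (‖x‖ - s * x 2)) = y at he
  have h1 := h.lap_eq hs y
  rw [h.eq s hs y, he] at h1
  have := (dpos y.1 y.2).ne'
  field_simp at h1
  linarith

lemma sol (h : Chart lam F) (h2 : 2 < lam) (hb : ∀ x ∈ S3, Real.exp (F x) ≤ 12 / lam) :
    Sol lam F (gradient F) (fderiv ℝ (gradient F)) where
  c2 := h.c2
  rad x hx := h.rad (S3_ne hx)
  Hx x hx := h.Hx (S3_ne hx)
  sym x hx a b := h.sym (S3_ne hx) a b
  we χ hχ := by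
    unfold Dir IP
    rw [green h.c2 hχ, ← integral_neg]
    refine int_congr fun x hx => ?_
    rw [h.SL_eq hx]; ring
  bd x hx := by
    have := hb x hx
    rw [le_div_iff₀ (by linarith)] at this
    linarith
  two := h2

end Chart

lemma chart_of_sol {lam : ℝ} {u : (Fin 3 → ℝ) → ℝ} (hu : IsMFSolution lam u) :
    Chart lam (fun x => u (nrmz x).ofLp) := by
  obtain ⟨_, cN, cS, eN, eS⟩ := hu
  have fN : (fun y => u (nrmz (sg 1 y)).ofLp) = fun y => u (stereoN y) := by
    funext y; rw [nrmz_of_mem (sg_mem (by norm_num) y), sg_N]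
  have fS : (fun y => u (nrmz (sg (-1) y)).ofLp) = fun y => u (stereoS y) := by
    funext y; rw [nrmz_of_mem (sg_mem (by norm_num) y), sg_S]
  refine ⟨fun z hz => ?_, fun s hs => ?_, fun s hs y => ?_⟩
  · simp only [nrmz_of_mem (nrmz_mem hz)]
  · rcases hs with rfl | rfl
    · simp only [fN]; exact cN
    · simp only [fS]; exact cS
  · rcases hs with rfl | rfl
    · have := congrFun fN y
      simp only at this
      simp only [fN, this]; exact eN y
    · have := congrFun fS y
      simp only at this
      simp only [fS, this]; exact eS y

/-- If `2 < λ ≤ 8` and `u` solves the mean field equation with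
`e^u ≤ 12/λ` on `S²`, then `u` is axially symmetric. -/
theorem bounded_solution_axially_symmetric (lam : ℝ) (hlam₁ : 2 < lam) (hlam₂ : lam ≤ 8)
    (u : (Fin 3 → ℝ) → ℝ) (hu : IsMFSolution lam u)
    (hbound : ∀ x ∈ sphere3, Real.exp (u x) ≤ 12 / lam) :
    AxiallySymmetric u := by
  have hS := (chart_of_sol hu).sol hlam₁ (fun x hx => by
    apply hbound
    rw [nrmz_of_mem hx]
    exact S3_sq hx)
  obtain ⟨R, hR⟩ := Sol.exists_diag hS.cF
  obtain ⟨i, hi⟩ := (hS.compR R).axis hR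
  have key : ∀ x : Fin 3 → ℝ, x ∈ sphere3 → ∃ X ∈ S3, u (nrmz (R X)).ofLp = u x ∧
      X i = x 0 * R (ee i) 0 + x 1 * R (ee i) 1 + x 2 * R (ee i) 2 := by
    intro x hx
    have hX : (WithLp.toLp 2 x : E3) ∈ S3 := S3_of_sq hx
    refine ⟨R.symm (WithLp.toLp 2 x), R_mem R.symm hX, ?_, ?_⟩
    · rw [R.apply_symm_apply, nrmz_of_mem hX]
    · rw [← inner_ee, ← R.inner_map_map, R.apply_symm_apply, inner3]
      simp only []
      ring
  refine ⟨(R (ee i)).ofLp, ?_, fun x hx x' hx' he => ?_⟩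
  · refine S3_sq (R_mem R ?_)
    rw [mem_S3]; simp [ee]
  · obtain ⟨X, hX, e1, e2⟩ := key x hx
    obtain ⟨X', hX', e1', e2'⟩ := key x' hx'
    rw [← e1, ← e1']
    exact hi X hX X' hX' (by rw [e2, e2']; exact he)
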